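/- arXiv:1812.08447 — 4 statements merged into one kernel-verified Lean document; each statement's English description precedes it below -/
import Mathlib

section
/- Let K be a simplicial complex of dimension 2 on n ≥ 3 vertices whose polyhedron ‖K‖ admits a topological embedding into ℝ². Then K has at most 2n−5 simplices of dimension 2. -/
/-- The polyhedron ‖K‖ ⊆ ℝ^n of a simplicial complex on vertex set Fin n. -/
def polyhedron (n : ℕ) (K : Finset (Finset (Fin n))) : Set (Fin n → ℝ) :=
  ⋃ F ∈ K, convexHull ℝ ((fun i : Fin n => (Pi.single i 1 : Fin n → ℝ)) '' (F : Set (Fin n)))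

/-- Mod 2 winding data of a graph drawn in the plane: `k v x y` is the parity of the full turns made
around `v` along the edge `x y`, relative to a choice of arguments of the directions between
vertices, and `ε x y` is the parity comparing the two arguments chosen for the directions
`x y` and `y x`. -/
structure WindingParity {α : Type*} (U : Finset α) (G : SimpleGraph α)
    (k : α → α → α → ZMod 2) (ε : α → α → ZMod 2) : Prop where
  symm : ∀ v x y, k v x y = k v y x
  tournament : ∀ x ∈ U, ∀ y ∈ U, x ≠ y → ε x y + ε y x = 1
  exchange : ∀ x ∈ U, ∀ y ∈ U, ∀ u ∈ U, ∀ v ∈ U, G.Adj x y → G.Adj u v →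
    x ≠ u → x ≠ v → y ≠ u → y ≠ v →
    k x u v + k y u v + k u x y + k v x y = ε x u + ε x v + ε y u + ε y v

namespace WindingParity

variable {α : Type*} {U V : Finset α} {G : SimpleGraph α}
  {k : α → α → α → ZMod 2} {ε : α → α → ZMod 2}

/-- The parity of the winding number of the closed path `x y z` around `v`. -/
def around (k : α → α → α → ZMod 2) (v x y z : α) : ZMod 2 := k v x y + k v y z + k v x z

theorem not_three_triangles (h : WindingParity U G k ε) {a b c₁ c₂ c₃ : α}
    (ha : a ∈ U) (hb : b ∈ U) (h₁ : c₁ ∈ U) (h₂ : c₂ ∈ U) (h₃ : c₃ ∈ U) (hab : a ≠ b)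
    (h₁₂ : c₁ ≠ c₂) (h₁₃ : c₁ ≠ c₃) (h₂₃ : c₂ ≠ c₃)
    (ha₁ : G.Adj a c₁) (ha₂ : G.Adj a c₂) (ha₃ : G.Adj a c₃)
    (hb₁ : G.Adj b c₁) (hb₂ : G.Adj b c₂) (hb₃ : G.Adj b c₃)
    (t₁ : around k c₂ a b c₁ = around k c₃ a b c₁)
    (t₂ : around k c₁ a b c₂ = around k c₃ a b c₂)
    (t₃ : around k c₁ a b c₃ = around k c₂ a b c₃) : False := by
  have e := h.exchange
  have e₁₂ := e a ha c₁ h₁ b hb c₂ h₂ ha₁ hb₂ hab ha₂.ne hb₁.ne' h₁₂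
  have e₁₃ := e a ha c₁ h₁ b hb c₃ h₃ ha₁ hb₃ hab ha₃.ne hb₁.ne' h₁₃
  have e₂₁ := e a ha c₂ h₂ b hb c₁ h₁ ha₂ hb₁ hab ha₁.ne hb₂.ne' h₁₂.symm
  have e₂₃ := e a ha c₂ h₂ b hb c₃ h₃ ha₂ hb₃ hab ha₃.ne hb₂.ne' h₂₃
  have e₃₁ := e a ha c₃ h₃ b hb c₁ h₁ ha₃ hb₁ hab ha₁.ne hb₃.ne' h₁₃.symm
  have e₃₂ := e a ha c₃ h₃ b hb c₂ h₂ ha₃ hb₂ hab ha₂.ne hb₃.ne' h₂₃.symm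
  have d₁₂ := h.tournament c₁ h₁ c₂ h₂ h₁₂
  have d₁₃ := h.tournament c₁ h₁ c₃ h₃ h₁₃
  have d₂₃ := h.tournament c₂ h₂ c₃ h₃ h₂₃
  have r₁ := h.tournament b hb c₁ h₁ hb₁.ne
  have r₂ := h.tournament b hb c₂ h₂ hb₂.ne
  have r₃ := h.tournament b hb c₃ h₃ hb₃.ne
  simp only [around] at t₁ t₂ t₃
  grind

theorem not_tetrahedron (h : WindingParity U G k ε) {a b c d v : α}
    (ha : a ∈ U) (hb : b ∈ U) (hc : c ∈ U) (hd : d ∈ U)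
    (hab : G.Adj a b) (hac : G.Adj a c) (had : G.Adj a d) (hbc : G.Adj b c) (hbd : G.Adj b d)
    (hcd : G.Adj c d)
    (t₁ : around k a b c d = around k v b c d) (t₂ : around k b a c d = around k v a c d)
    (t₃ : around k c a b d = around k v a b d) (t₄ : around k d a b c = around k v a b c) :
    False := by
  have e := h.exchange
  have e₁ := e a ha b hb c hc d hd hab hcd hac.ne had.ne hbc.ne hbd.ne
  have e₂ := e a ha c hc b hb d hd hac hbd hab.ne had.ne hbc.ne' hcd.ne
  have e₃ := e a ha d hd b hb c hc had hbc hab.ne hac.ne hbd.ne' hcd.ne'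
  have d₁ := h.tournament c hc d hd hcd.ne
  have d₂ := h.tournament b hb c hc hbc.ne
  have d₃ := h.tournament b hb d hd hbd.ne
  simp only [around] at t₁ t₂ t₃ t₄
  grind

theorem around_eq_of_adj (h : WindingParity U G k ε) {x y z u v : α}
    (hx : x ∈ U) (hy : y ∈ U) (hz : z ∈ U) (hu : u ∈ U) (hv : v ∈ U)
    (hxy : G.Adj x y) (hyz : G.Adj y z) (hxz : G.Adj x z) (huv : G.Adj u v)
    (hux : u ≠ x) (huy : u ≠ y) (huz : u ≠ z) (hvx : v ≠ x) (hvy : v ≠ y) (hvz : v ≠ z) :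
    around k u x y z = around k v x y z := by
  have e := h.exchange
  have e₁ := e x hx y hy u hu v hv hxy huv hux.symm hvx.symm huy.symm hvy.symm
  have e₂ := e y hy z hz u hu v hv hyz huv huy.symm hvy.symm huz.symm hvz.symm
  have e₃ := e x hx z hz u hu v hv hxz huv hux.symm hvx.symm huz.symm hvz.symm
  simp only [around]
  grind


/-- A triangle of `G` whose boundary winds equally often, modulo 2, around all
other points of `V`. -/
structure IsFace (V U : Finset α) (G : SimpleGraph α) (k : α → α → α → ZMod 2) (a b c : α) :
    Prop where
  mem₁ : a ∈ U
  mem₂ : b ∈ U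
  mem₃ : c ∈ U
  adj₁₂ : G.Adj a b
  adj₂₃ : G.Adj b c
  adj₁₃ : G.Adj a c
  around_eq : ∀ v ∈ V, ∀ w ∈ V, v ≠ a → v ≠ b → v ≠ c → w ≠ a → w ≠ b → w ≠ c →
    around k v a b c = around k w a b c

theorem IsFace.swap (h : WindingParity U G k ε) {a b c : α} (t : IsFace V U G k a b c) :
    IsFace V U G k b a c := by
  refine ⟨t.mem₂, t.mem₁, t.mem₃, t.adj₁₂.symm, t.adj₁₃, t.adj₂₃, ?_⟩
  intro v hv w hw h₁ h₂ h₃ h₄ h₅ h₆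
  have := t.around_eq v hv w hw h₂ h₁ h₃ h₅ h₄ h₆
  simp only [around, h.symm _ b a] at this ⊢
  grind

theorem IsFace.rotate (h : WindingParity U G k ε) {a b c : α} (t : IsFace V U G k a b c) :
    IsFace V U G k b c a := by
  refine ⟨t.mem₂, t.mem₃, t.mem₁, t.adj₂₃, t.adj₁₃.symm, t.adj₁₂.symm, ?_⟩
  intro v hv w hw h₁ h₂ h₃ h₄ h₅ h₆
  have := t.around_eq v hv w hw h₃ h₁ h₂ h₆ h₄ h₅
  simp only [around, h.symm _ b a, h.symm _ c a] at this ⊢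
  grind

open Classical in
/-- The vertex sets of all faces. -/
noncomputable def faces (V U : Finset α) (G : SimpleGraph α) (k : α → α → α → ZMod 2) :
    Finset (Finset α) :=
  U.powerset.filter fun t => ∃ a b c, t = {a, b, c} ∧ IsFace V U G k a b c

open Classical in
theorem mem_faces {t : Finset α} :
    t ∈ faces V U G k ↔ ∃ a b c, t = {a, b, c} ∧ IsFace V U G k a b c := by
  simp only [faces, Finset.mem_filter, Finset.mem_powerset, and_iff_right_iff_imp]
  rintro ⟨a, b, c, rfl, h⟩
  have := h.mem₁
  have := h.mem₂
  have := h.mem₃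
  intro x
  simp only [Finset.mem_insert, Finset.mem_singleton]
  rintro (rfl | rfl | rfl) <;> assumption

open Classical in
theorem exists_of_mem_faces (h : WindingParity U G k ε) {t : Finset α} {x : α}
    (ht : t ∈ faces V U G k) (hx : x ∈ t) : ∃ b c, t = {x, b, c} ∧ IsFace V U G k x b c := by
  obtain ⟨a, b, c, rfl, f⟩ := mem_faces.1 ht
  simp only [Finset.mem_insert, Finset.mem_singleton] at hx
  rcases hx with rfl | rfl | rfl
  · exact ⟨b, c, rfl, f⟩
  · exact ⟨a, c, Finset.insert_comm _ _ _, f.swap h⟩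
  · refine ⟨a, b, ?_, (f.rotate h).rotate h⟩
    ext; simp only [Finset.mem_insert, Finset.mem_singleton]; tauto

open Classical in
theorem exists_of_mem_faces_of_ne (h : WindingParity U G k ε) {t : Finset α} {x y : α}
    (ht : t ∈ faces V U G k) (hx : x ∈ t) (hy : y ∈ t) (hxy : x ≠ y) :
    ∃ c, t = {x, y, c} ∧ IsFace V U G k x y c := by
  obtain ⟨b, c, rfl, f⟩ := exists_of_mem_faces h ht hx
  simp only [Finset.mem_insert, Finset.mem_singleton] at hy
  rcases hy with rfl | rfl | rfl
  · exact absurd rfl hxy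
  · exact ⟨c, rfl, f⟩
  · exact ⟨b, by rw [Finset.pair_comm], ((f.rotate h).rotate h).swap h⟩

theorem card_of_mem_faces {t : Finset α} (ht : t ∈ faces V U G k) : t.card = 3 := by
  classical
  obtain ⟨a, b, c, rfl, f⟩ := mem_faces.1 ht
  exact Finset.card_eq_three.2 ⟨a, b, c, f.adj₁₂.ne, f.adj₁₃.ne, f.adj₂₃.ne, rfl⟩

open Classical in
theorem isFace_of_mem_faces (h : WindingParity U G k ε) {a b c : α}
    (hab : a ≠ b) (ht : {a, b, c} ∈ faces V U G k) : IsFace V U G k a b c := by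
  obtain ⟨d, hd, f⟩ := exists_of_mem_faces_of_ne h ht (x := a) (y := b) (by simp) (by simp) hab
  have hc : c ∈ ({a, b, d} : Finset α) := hd ▸ (by simp)
  have hcard := card_of_mem_faces ht
  simp only [Finset.mem_insert, Finset.mem_singleton] at hc
  rcases hc with rfl | rfl | rfl
  · have := (Finset.card_le_two (a := c) (b := b))
    rw [Finset.pair_comm b c, Finset.insert_idem] at hcard
    omega
  · have := (Finset.card_le_two (a := a) (b := c))
    rw [Finset.pair_eq_singleton] at hcard
    omega
  · exact f

open Classical in
theorem card_faces_filter_le_two (h : WindingParity U G k ε) (hUV : U ⊆ V) {x y : α}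
    (hxy : x ≠ y) : ((faces V U G k).filter fun t => x ∈ t ∧ y ∈ t).card ≤ 2 := by
  by_contra! hlt
  obtain ⟨t₁, t₂, t₃, h₁, h₂, h₃, h₁₂, h₁₃, h₂₃⟩ := Finset.two_lt_card_iff.1 hlt
  simp only [Finset.mem_filter] at h₁ h₂ h₃
  obtain ⟨c₁, rfl, f₁⟩ := exists_of_mem_faces_of_ne h h₁.1 h₁.2.1 h₁.2.2 hxy
  obtain ⟨c₂, rfl, f₂⟩ := exists_of_mem_faces_of_ne h h₂.1 h₂.2.1 h₂.2.2 hxy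
  obtain ⟨c₃, rfl, f₃⟩ := exists_of_mem_faces_of_ne h h₃.1 h₃.2.1 h₃.2.2 hxy
  have n₁₂ : c₁ ≠ c₂ := fun e => h₁₂ (by rw [e])
  have n₁₃ : c₁ ≠ c₃ := fun e => h₁₃ (by rw [e])
  have n₂₃ : c₂ ≠ c₃ := fun e => h₂₃ (by rw [e])
  have m₁ := hUV f₁.mem₃
  have m₂ := hUV f₂.mem₃
  have m₃ := hUV f₃.mem₃
  have x₁ := f₁.adj₁₃.ne'
  have x₂ := f₂.adj₁₃.ne'
  have x₃ := f₃.adj₁₃.ne'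
  have y₁ := f₁.adj₂₃.ne'
  have y₂ := f₂.adj₂₃.ne'
  have y₃ := f₃.adj₂₃.ne'
  exact h.not_three_triangles f₁.mem₁ f₁.mem₂ f₁.mem₃ f₂.mem₃ f₃.mem₃ hxy n₁₂ n₁₃ n₂₃
    f₁.adj₁₃ f₂.adj₁₃ f₃.adj₁₃ f₁.adj₂₃ f₂.adj₂₃ f₃.adj₂₃
    (f₁.around_eq _ m₂ _ m₃ x₂ y₂ n₁₂.symm x₃ y₃ n₁₃.symm)
    (f₂.around_eq _ m₁ _ m₃ x₁ y₁ n₁₂ x₃ y₃ n₂₃.symm)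
    (f₃.around_eq _ m₁ _ m₂ x₁ y₁ n₁₃ x₂ y₂ n₂₃)

/-- The graph obtained by contracting the edge `x y` to `y`. -/
def contractGraph (G : SimpleGraph α) (x y : α) : SimpleGraph α where
  Adj a b := a ≠ b ∧ (G.Adj a b ∨ (a = y ∧ G.Adj x b) ∨ (b = y ∧ G.Adj x a))
  symm := ⟨by
    rintro a b ⟨h, h'⟩
    refine ⟨h.symm, ?_⟩
    rcases h' with h' | h' | h'
    · exact Or.inl h'.symm
    · exact Or.inr (Or.inr h')
    · exact Or.inr (Or.inl h')⟩
  loopless := ⟨fun _ h => h.1 rfl⟩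

open Classical in
/-- The parity of the edge `y b` seen from `v` after the contraction of `x y` to `y`. -/
noncomputable def contractEdge (G : SimpleGraph α) (k : α → α → α → ZMod 2) (x y v b : α) :
    ZMod 2 :=
  if G.Adj y b then k v y b else k v x b + k v x y

open Classical in
/-- The parities after the contraction of `x y` to `y`. -/
noncomputable def contractParity (G : SimpleGraph α) (k : α → α → α → ZMod 2) (x y : α)
    (v a b : α) : ZMod 2 :=
  if a = y then contractEdge G k x y v b else
    if b = y then contractEdge G k x y v a else k v a b

theorem contractParity_left (x y v b : α) :
    contractParity G k x y v y b = contractEdge G k x y v b := by simp [contractParity]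

theorem contractParity_of_ne {x y v a b : α} (ha : a ≠ y) (hb : b ≠ y) :
    contractParity G k x y v a b = k v a b := by simp [contractParity, ha, hb]

theorem contractParity_symm (h : WindingParity U G k ε) (x y v a b : α) :
    contractParity G k x y v a b = contractParity G k x y v b a := by
  unfold contractParity
  split_ifs <;> simp_all [h.symm v a b]

theorem exists_contractEdge_eq {x y b : α}
    (hfull : G.Adj y b → IsFace V U G k x y b) :
    ∃ l, ∀ v ∈ V, v ≠ x → v ≠ y → v ≠ b → contractEdge G k x y v b = k v x b + k v x y + l := by
  by_cases hy : G.Adj y b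
  · by_cases hv : ∃ v ∈ V, v ≠ x ∧ v ≠ y ∧ v ≠ b
    · obtain ⟨w, hw, h₁, h₂, h₃⟩ := hv
      refine ⟨around k w x y b, fun v hv g₁ g₂ g₃ => ?_⟩
      have := (hfull hy).around_eq v hv w hw g₁ g₂ g₃ h₁ h₂ h₃
      rw [← this]
      simp only [contractEdge, if_pos hy, around]
      grind
    · push Not at hv
      exact ⟨0, fun v h₁ h₂ h₃ h₄ => absurd (hv v h₁ h₂ h₃) h₄⟩
  · exact ⟨0, fun v h₁ h₂ h₃ h₄ => by simp [contractEdge, hy]⟩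

theorem contract_exchange (h : WindingParity U G k ε) {x y b u v : α}
    (hx : x ∈ U) (hy : y ∈ U) (hb : b ∈ U) (hu : u ∈ U) (hv : v ∈ U)
    (hxy : G.Adj x y) (huv : G.Adj u v) (hyb : G.Adj y b ∨ G.Adj x b)
    (hux : u ≠ x) (huy : u ≠ y) (hvx : v ≠ x) (hvy : v ≠ y)
    (hbu : b ≠ u) (hbv : b ≠ v) :
    k y u v + k b u v + contractEdge G k x y u b + contractEdge G k x y v b =
      ε y u + ε y v + ε b u + ε b v := by
  by_cases hyb' : G.Adj y b
  · simp only [contractEdge, if_pos hyb']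
    exact h.exchange y hy b hb u hu v hv hyb' huv huy.symm hvy.symm hbu hbv
  · have hxb := hyb.resolve_left hyb'
    have e₁ := h.exchange x hx b hb u hu v hv hxb huv hux.symm hvx.symm hbu hbv
    have e₂ := h.exchange x hx y hy u hu v hv hxy huv hux.symm hvx.symm huy.symm hvy.symm
    simp only [contractEdge, if_neg hyb']
    grind

open Classical in
theorem contract (h : WindingParity U G k ε) {x y : α}
    (hx : x ∈ U) (hy : y ∈ U) (hxy : G.Adj x y) :
    WindingParity (U.erase x) (contractGraph G x y) (contractParity G k x y) ε := by
  have tour := h.tournament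
  have key : ∀ b ∈ U.erase x, ∀ u ∈ U.erase x, ∀ v ∈ U.erase x,
      (contractGraph G x y).Adj y b → (contractGraph G x y).Adj u v → y ≠ u → y ≠ v →
      b ≠ u → b ≠ v →
      contractParity G k x y y u v + contractParity G k x y b u v +
        contractParity G k x y u y b + contractParity G k x y v y b =
      ε y u + ε y v + ε b u + ε b v := by
    intro b hb u hu v hv hyb huv hyu hyv hbu hbv
    simp only [Finset.mem_erase] at hb hu hv
    simp only [contractParity_left, contractParity_of_ne hyu.symm hyv.symm]
    have huv' : G.Adj u v := by
      rcases huv.2 with h | h | h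
      · exact h
      · exact absurd h.1.symm hyu
      · exact absurd h.1.symm hyv
    have hyb' : G.Adj y b ∨ G.Adj x b := by
      rcases hyb.2 with h | h | h
      · exact Or.inl h
      · exact Or.inr h.2
      · exact absurd h.1.symm hyb.1
    exact h.contract_exchange hx hy hb.2 hu.2 hv.2 hxy huv' hyb' hu.1 hyu.symm hv.1 hyv.symm hbu hbv
  have symm := h.contractParity_symm x y
  refine ⟨symm, fun a ha b hb => tour a (Finset.mem_of_mem_erase ha)
    b (Finset.mem_of_mem_erase hb), ?_⟩
  intro a ha b hb u hu v hv hab huv hau hav hbu hbv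
  have t₁ := tour a (Finset.mem_of_mem_erase ha) u (Finset.mem_of_mem_erase hu) hau
  have t₂ := tour a (Finset.mem_of_mem_erase ha) v (Finset.mem_of_mem_erase hv) hav
  have t₃ := tour b (Finset.mem_of_mem_erase hb) u (Finset.mem_of_mem_erase hu) hbu
  have t₄ := tour b (Finset.mem_of_mem_erase hb) v (Finset.mem_of_mem_erase hv) hbv
  by_cases hay : a = y
  · subst hay
    exact key b hb u hu v hv hab huv hau hav hbu hbv
  by_cases hby : b = y
  · subst hby
    have := key a ha u hu v hv hab.symm huv hbu hbv hau hav
    rw [symm u a b, symm v a b]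
    grind
  by_cases huy : u = y
  · subst huy
    have := key v hv a ha b hb huv hab hau.symm hbu.symm hav.symm hbv.symm
    grind
  by_cases hvy : v = y
  · subst hvy
    have := key u hu a ha b hb huv.symm hab hav.symm hbv.symm hau.symm hbu.symm
    rw [symm a u v, symm b u v]
    grind
  simp only [contractParity_of_ne hay hby, contractParity_of_ne huy hvy]
  have hab' : G.Adj a b := by
    rcases hab.2 with h | h | h
    exacts [h, absurd h.1 hay, absurd h.1 hby]
  have huv' : G.Adj u v := by
    rcases huv.2 with h | h | h
    exacts [h, absurd h.1 huy, absurd h.1 hvy]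
  exact h.exchange a (Finset.mem_of_mem_erase ha) b (Finset.mem_of_mem_erase hb)
    u (Finset.mem_of_mem_erase hu) v (Finset.mem_of_mem_erase hv) hab' huv' hau hav hbu hbv

open Classical in
theorem IsFace.contract_of_left {x y a b : α}
    (hy : y ∈ U) (hxy : G.Adj x y)
    (hfull : ∀ b ∈ U, G.Adj x b → G.Adj y b → IsFace V U G k x y b)
    (t : IsFace V U G k x a b) (hya : y ≠ a) (hyb : y ≠ b) :
    IsFace (V.erase x) (U.erase x) (contractGraph G x y) (contractParity G k x y) y a b := by
  have ha := t.adj₁₂.ne'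
  have hb := t.adj₁₃.ne'
  refine ⟨Finset.mem_erase.2 ⟨hxy.ne', hy⟩, Finset.mem_erase.2 ⟨ha, t.mem₂⟩,
    Finset.mem_erase.2 ⟨hb, t.mem₃⟩, ⟨hya, .inr (.inl ⟨rfl, t.adj₁₂⟩)⟩,
    ⟨t.adj₂₃.ne, .inl t.adj₂₃⟩, ⟨hyb, .inr (.inl ⟨rfl, t.adj₁₃⟩)⟩, ?_⟩
  obtain ⟨l, hl⟩ := exists_contractEdge_eq (hfull a t.mem₂ t.adj₁₂)
  obtain ⟨m, hm⟩ := exists_contractEdge_eq (hfull b t.mem₃ t.adj₁₃)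
  intro v hv w hw h₁ h₂ h₃ h₄ h₅ h₆
  rw [Finset.mem_erase] at hv hw
  have := t.around_eq v hv.2 w hw.2 hv.1 h₂ h₃ hw.1 h₅ h₆
  simp only [around, contractParity_left, contractParity_of_ne hya.symm hyb.symm,
    hl v hv.2 hv.1 h₁ h₂, hl w hw.2 hw.1 h₄ h₅, hm v hv.2 hv.1 h₁ h₃, hm w hw.2 hw.1 h₄ h₆] at this ⊢
  grind

open Classical in
theorem IsFace.contract_of_right {x y a b : α}
    (hxy : G.Adj x y) (t : IsFace V U G k y a b) (hxa : x ≠ a) (hxb : x ≠ b) :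
    IsFace (V.erase x) (U.erase x) (contractGraph G x y) (contractParity G k x y) y a b := by
  refine ⟨Finset.mem_erase.2 ⟨hxy.ne', t.mem₁⟩, Finset.mem_erase.2 ⟨hxa.symm, t.mem₂⟩,
    Finset.mem_erase.2 ⟨hxb.symm, t.mem₃⟩, ⟨t.adj₁₂.ne, .inl t.adj₁₂⟩,
    ⟨t.adj₂₃.ne, .inl t.adj₂₃⟩, ⟨t.adj₁₃.ne, .inl t.adj₁₃⟩, ?_⟩
  intro v hv w hw h₁ h₂ h₃ h₄ h₅ h₆
  rw [Finset.mem_erase] at hv hw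
  have := t.around_eq v hv.2 w hw.2 h₁ h₂ h₃ h₄ h₅ h₆
  simpa only [around, contractParity_left, contractParity_of_ne t.adj₁₂.ne' t.adj₁₃.ne',
    contractEdge, if_pos t.adj₁₂, if_pos t.adj₁₃] using this

open Classical in
theorem IsFace.contract_of_ne {x y a b c : α}
    (t : IsFace V U G k a b c) (hxa : x ≠ a) (hxb : x ≠ b) (hxc : x ≠ c)
    (hya : y ≠ a) (hyb : y ≠ b) (hyc : y ≠ c) :
    IsFace (V.erase x) (U.erase x) (contractGraph G x y) (contractParity G k x y) a b c := by
  refine ⟨Finset.mem_erase.2 ⟨hxa.symm, t.mem₁⟩, Finset.mem_erase.2 ⟨hxb.symm, t.mem₂⟩,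
    Finset.mem_erase.2 ⟨hxc.symm, t.mem₃⟩, ⟨t.adj₁₂.ne, .inl t.adj₁₂⟩,
    ⟨t.adj₂₃.ne, .inl t.adj₂₃⟩, ⟨t.adj₁₃.ne, .inl t.adj₁₃⟩, ?_⟩
  intro v hv w hw h₁ h₂ h₃ h₄ h₅ h₆
  rw [Finset.mem_erase] at hv hw
  simpa only [around, contractParity_of_ne hya.symm hyb.symm, contractParity_of_ne hya.symm hyc.symm,
    contractParity_of_ne hyb.symm hyc.symm] using t.around_eq v hv.2 w hw.2 h₁ h₂ h₃ h₄ h₅ h₆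

open Classical in
theorem card_faces_le_contract (h : WindingParity U G k ε) (hUV : U ⊆ V) (hV : 5 ≤ V.card)
    {x y : α} (hx : x ∈ U) (hy : y ∈ U) (hxy : G.Adj x y)
    (hfull : ∀ a ∈ U, ∀ b ∈ U, ∀ c ∈ U, G.Adj a b → G.Adj b c → G.Adj a c →
      IsFace V U G k a b c) :
    (faces V U G k).card ≤
      (faces (V.erase x) (U.erase x) (contractGraph G x y) (contractParity G k x y)).card + 2 := by
  have hfull' : ∀ b ∈ U, G.Adj x b → G.Adj y b → IsFace V U G k x y b :=
    fun b hb h₁ h₂ => hfull x hx y hy b hb hxy h₂ h₁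
  have mixed : ∀ s t : Finset α, s ∈ faces V U G k → t ∈ faces V U G k → x ∈ s → x ∉ t →
      y ∉ s → insert y (s.erase x) = t → False := by
    intro s t hs ht hxs hxt hys e
    obtain ⟨a, b, rfl, f⟩ := exists_of_mem_faces h hs hxs
    have hxa := f.adj₁₂.ne
    have hxb := f.adj₁₃.ne
    rw [Finset.erase_insert (by simp [hxa, hxb])] at e
    subst e
    simp only [Finset.mem_insert, Finset.mem_singleton, not_or] at hys
    have g := isFace_of_mem_faces h hys.2.1 ht
    have fa := hfull' a f.mem₂ f.adj₁₂ g.adj₁₂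
    have fb := hfull' b f.mem₃ f.adj₁₃ g.adj₁₃
    obtain ⟨v, hv, hv'⟩ : ∃ v ∈ V, v ∉ ({x, y, a, b} : Finset α) := by
      refine Finset.exists_mem_notMem_of_card_lt_card ?_
      have := Finset.card_le_four (a := x) (b := y) (c := a) (d := b)
      omega
    simp only [Finset.mem_insert, Finset.mem_singleton, not_or] at hv'
    obtain ⟨vx, vy, va, vb⟩ := hv'
    exact h.not_tetrahedron hx hy f.mem₂ f.mem₃ hxy f.adj₁₂ f.adj₁₃ g.adj₁₂ g.adj₁₃ f.adj₂₃
      (g.around_eq _ (hUV hx) v hv hxy.ne hxa hxb vy va vb)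
      (f.around_eq _ (hUV hy) v hv hxy.ne' hys.2.1 hys.2.2 vx va vb)
      (fb.around_eq _ (hUV f.mem₂) v hv hxa.symm g.adj₁₂.ne' f.adj₂₃.ne vx vy vb)
      (fa.around_eq _ (hUV f.mem₃) v hv hxb.symm g.adj₁₃.ne' f.adj₂₃.ne' vx vy va)
  have hle := card_faces_filter_le_two (V := V) h hUV hxy.ne
  rw [← Finset.card_filter_add_card_filter_not (s := faces V U G k) (fun t => x ∈ t ∧ y ∈ t),
    add_comm]
  refine Nat.add_le_add ?_ hle
  refine Finset.card_le_card_of_injOn (fun t => if x ∈ t then insert y (t.erase x) else t) ?_ ?_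
  · intro t ht
    simp only [Finset.coe_filter, Set.mem_ofPred_eq, not_and] at ht
    obtain ⟨ht, hxyt⟩ := ht
    simp only [Finset.mem_coe]
    split_ifs with hxt
    · have hyt := hxyt hxt
      obtain ⟨a, b, rfl, f⟩ := exists_of_mem_faces h ht hxt
      simp only [Finset.mem_insert, Finset.mem_singleton, not_or] at hyt
      rw [Finset.erase_insert (by simp [f.adj₁₂.ne, f.adj₁₃.ne])]
      exact mem_faces.2 ⟨y, a, b, rfl, f.contract_of_left hy hxy hfull' hyt.2.1 hyt.2.2⟩
    · by_cases hyt : y ∈ t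
      · obtain ⟨a, b, rfl, f⟩ := exists_of_mem_faces h ht hyt
        simp only [Finset.mem_insert, Finset.mem_singleton, not_or] at hxt
        exact mem_faces.2 ⟨y, a, b, rfl, f.contract_of_right hxy hxt.2.1 hxt.2.2⟩
      · obtain ⟨a, b, c, rfl, f⟩ := mem_faces.1 ht
        simp only [Finset.mem_insert, Finset.mem_singleton, not_or] at hxt hyt
        exact mem_faces.2 ⟨a, b, c, rfl, f.contract_of_ne hxt.1 hxt.2.1 hxt.2.2
          hyt.1 hyt.2.1 hyt.2.2⟩
  · intro s hs t ht e
    simp only [Finset.coe_filter, Set.mem_ofPred_eq, not_and] at hs ht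
    dsimp only at e
    split_ifs at e with h₁ h₂ h₂
    · have h₃ := hs.2 h₁
      have h₄ := ht.2 h₂
      rw [← Finset.insert_erase h₁, ← Finset.insert_erase h₂]
      have := congrArg (Finset.erase · y) e
      rw [Finset.erase_insert (by simp [h₃]), Finset.erase_insert (by simp [h₄])] at this
      rw [this]
    · exact (mixed s t hs.1 ht.1 h₁ h₂ (hs.2 h₁) e).elim
    · exact (mixed t s ht.1 hs.1 h₂ h₁ (ht.2 h₂) e.symm).elim
    · exact e

theorem mono {U' : Finset α} (h : WindingParity U G k ε) (hU : U' ⊆ U) :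
    WindingParity U' G k ε :=
  ⟨h.symm, fun x hx y hy => h.tournament x (hU hx) y (hU hy),
    fun x hx y hy u hu v hv => h.exchange x (hU hx) y (hU hy) u (hU hu) v (hU hv)⟩

theorem IsFace.restrict {U' V' : Finset α} {a b c : α} (t : IsFace V U G k a b c)
    (hV : V' ⊆ V) (ha : a ∈ U') (hb : b ∈ U') (hc : c ∈ U') : IsFace V' U' G k a b c :=
  ⟨ha, hb, hc, t.adj₁₂, t.adj₂₃, t.adj₁₃, fun v hv w hw => t.around_eq v (hV hv) w (hV hw)⟩

/-- The points of `V` around which the closed path `a b c` winds with parity `i`, together with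
`a`, `b`, `c`. -/
def side [DecidableEq α] (V : Finset α) (k : α → α → α → ZMod 2) (a b c : α) (i : ZMod 2) :
    Finset α :=
  V.filter fun v => v = a ∨ v = b ∨ v = c ∨ around k v a b c = i

theorem mem_side [DecidableEq α] {a b c v : α} {i : ZMod 2} :
    v ∈ side V k a b c i ↔ v ∈ V ∧ ((v = a ∨ v = b ∨ v = c) ∨ around k v a b c = i) := by
  simp only [side, Finset.mem_filter, or_assoc]

theorem side_subset [DecidableEq α] (V : Finset α) (k : α → α → α → ZMod 2) (a b c : α)
    (i : ZMod 2) : side V k a b c i ⊆ V := Finset.filter_subset _ _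

open Classical in
theorem card_side_add_card_side {a b c : α} (ha : a ∈ V) (hb : b ∈ V) (hc : c ∈ V)
    (hab : a ≠ b) (hac : a ≠ c) (hbc : b ≠ c) :
    (side V k a b c 0).card + (side V k a b c 1).card = V.card + 3 := by
  rw [← Finset.card_union_add_card_inter]
  congr 1
  · congr 1
    ext v
    have : ∀ i : ZMod 2, i = 0 ∨ i = 1 := by decide
    have := this (around k v a b c)
    simp only [side, Finset.mem_union, Finset.mem_filter]
    tauto
  · rw [Finset.card_eq_three]
    refine ⟨a, b, c, hab, hac, hbc, ?_⟩
    ext v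
    simp only [side, Finset.mem_inter, Finset.mem_filter, Finset.mem_insert, Finset.mem_singleton]
    constructor
    · rintro ⟨⟨_, h₁⟩, _, h₂⟩
      have : ¬ (around k v a b c = 0 ∧ around k v a b c = 1) := by
        rintro ⟨e, e'⟩
        rw [e] at e'
        exact absurd e' (by decide)
      tauto
    · rintro (rfl | rfl | rfl) <;> simp_all

theorem faces_subset_sides [DecidableEq α] (h : WindingParity U G k ε) {a b c : α}
    (ha : a ∈ U) (hb : b ∈ U) (hc : c ∈ U) (hab : G.Adj a b) (hbc : G.Adj b c) (hac : G.Adj a c)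
    {t : Finset α} (ht : t ∈ faces V U G k) :
    ∃ i, t ∈ faces (side V k a b c i) (side U k a b c i) G k := by
  obtain ⟨p, q, r, rfl, f⟩ := mem_faces.1 ht
  have key : ∀ u v, u ∈ U → v ∈ U → G.Adj u v →
      (u = a ∨ u = b ∨ u = c) ∨ (v = a ∨ v = b ∨ v = c) ∨
        around k u a b c = around k v a b c := by
    intro u v hu hv huv
    by_cases h₁ : u = a ∨ u = b ∨ u = c
    · exact Or.inl h₁
    by_cases h₂ : v = a ∨ v = b ∨ v = c
    · exact Or.inr (Or.inl h₂)
    push Not at h₁ h₂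
    exact Or.inr (Or.inr (h.around_eq_of_adj ha hb hc hu hv hab hbc hac huv h₁.1 h₁.2.1 h₁.2.2
      h₂.1 h₂.2.1 h₂.2.2))
  have k₁ := key p q f.mem₁ f.mem₂ f.adj₁₂
  have k₂ := key q r f.mem₂ f.mem₃ f.adj₂₃
  have k₃ := key p r f.mem₁ f.mem₃ f.adj₁₃
  obtain ⟨i, h₁, h₂, h₃⟩ : ∃ i, p ∈ side U k a b c i ∧ q ∈ side U k a b c i ∧
      r ∈ side U k a b c i := by
    simp only [mem_side, f.mem₁, f.mem₂, f.mem₃, true_and]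
    clear key
    generalize (p = a ∨ p = b ∨ p = c) = P at *
    generalize (q = a ∨ q = b ∨ q = c) = Q at *
    generalize (r = a ∨ r = b ∨ r = c) = R at *
    by_cases hP : P
    · by_cases hQ : Q
      · exact ⟨_, .inl hP, .inl hQ, .inr rfl⟩
      · refine ⟨_, .inl hP, .inr rfl, ?_⟩
        rcases k₂ with h | h | h
        exacts [absurd h hQ, .inl h, .inr h.symm]
    · refine ⟨_, .inr rfl, ?_, ?_⟩
      · rcases k₁ with h | h | h
        exacts [absurd h hP, .inl h, .inr h.symm]
      · rcases k₃ with h | h | h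
        exacts [absurd h hP, .inl h, .inr h.symm]
  exact ⟨i, mem_faces.2 ⟨p, q, r, rfl, f.restrict (side_subset _ _ _ _ _ _) h₁ h₂ h₃⟩⟩

theorem isFace_side [DecidableEq α] {a b c : α}
    (ha : a ∈ U) (hb : b ∈ U) (hc : c ∈ U) (hab : G.Adj a b) (hbc : G.Adj b c) (hac : G.Adj a c)
    (i : ZMod 2) : IsFace (side V k a b c i) (side U k a b c i) G k a b c := by
  refine ⟨by simp [side, ha], by simp [side, hb], by simp [side, hc], hab, hbc, hac, ?_⟩
  intro v hv w hw h₁ h₂ h₃ h₄ h₅ h₆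
  simp only [side, Finset.mem_filter] at hv hw
  have e₁ : around k v a b c = i := by tauto
  have e₂ : around k w a b c = i := by tauto
  rw [e₁, e₂]

open Classical in
theorem card_faces_le (h : WindingParity U G k ε) (hUV : U ⊆ V) (hU : 3 ≤ U.card)
    (hVU : V.card ≤ U.card + 1) : (faces V U G k).card + 4 + V.card ≤ 3 * U.card := by
  induction hN : V.card using Nat.strong_induction_on generalizing V U G k ε with
  | _ N ih =>
  subst hN
  have hpow : (faces V U G k).card ≤ U.card.choose 3 := by
    rw [← Finset.card_powersetCard]
    refine Finset.card_le_card fun t ht => ?_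
    rw [Finset.mem_powersetCard]
    exact ⟨Finset.mem_powerset.1 (Finset.mem_filter.1 ht).1, card_of_mem_faces ht⟩
  have hUV' := Finset.card_le_card hUV
  by_cases hfull : ∀ a ∈ U, ∀ b ∈ U, ∀ c ∈ U, G.Adj a b → G.Adj b c → G.Adj a c →
      IsFace V U G k a b c
  · rcases hU.eq_or_lt with h₃ | h₃
    · rw [← h₃, Nat.choose_self] at hpow
      omega
    rcases Nat.lt_or_ge V.card 5 with h₅ | h₅
    · have h₄ : U.card = 4 := by omega
      rw [h₄, show Nat.choose 4 3 = 4 from rfl] at hpow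
      omega
    rcases (faces V U G k).eq_empty_or_nonempty with h₀ | ⟨t, ht⟩
    · rw [h₀, Finset.card_empty]
      omega
    · obtain ⟨x, y, c, rfl, f⟩ := mem_faces.1 ht
      have hx := f.mem₁
      have hy := f.mem₂
      have hle := card_faces_le_contract h hUV h₅ hx hy f.adj₁₂ hfull
      have c₁ := Finset.card_erase_of_mem hx
      have c₂ := Finset.card_erase_of_mem (hUV hx)
      have := ih _ (by omega) (h.contract hx hy f.adj₁₂) (Finset.erase_subset_erase x hUV)
        (by omega) (by omega) rfl
      omega
  · push Not at hfull
    obtain ⟨a, ha, b, hb, c, hc, hab, hbc, hac, hnot⟩ := hfull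
    have hne : ∃ v ∈ V, ∃ w ∈ V, v ∉ side V k a b c 0 ∧ w ∉ side V k a b c 1 := by
      by_contra! hcon
      refine hnot ⟨ha, hb, hc, hab, hbc, hac, ?_⟩
      intro v hv w hw h₁ h₂ h₃ h₄ h₅ h₆
      have d : ∀ i j : ZMod 2, i = j ∨ (i ≠ 0 ∧ j ≠ 1) ∨ (j ≠ 0 ∧ i ≠ 1) := by decide
      rcases d (around k v a b c) (around k w a b c) with e | e | e
      · exact e
      · exact absurd (hcon v hv w hw (by simp [side, *])) (by simp [side, *])
      · exact absurd (hcon w hw v hv (by simp [side, *])) (by simp [side, *])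
    obtain ⟨v, hv, w, hw, hv₀, hw₁⟩ := hne
    have cV := card_side_add_card_side (k := k) (hUV ha) (hUV hb) (hUV hc) hab.ne hac.ne hbc.ne
    have cU := card_side_add_card_side (k := k) ha hb hc hab.ne hac.ne hbc.ne
    have hlt : ∀ i u, u ∈ V → u ∉ side V k a b c i → (side V k a b c i).card < V.card :=
      fun i u hu hu' => Finset.card_lt_card
        ⟨side_subset _ _ _ _ _ _, fun hs => hu' (hs hu)⟩
    have lt₀ := hlt 0 v hv hv₀
    have lt₁ := hlt 1 w hw hw₁
    have hsub : ∀ i, side U k a b c i ⊆ side V k a b c i :=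
      fun i => Finset.filter_subset_filter _ hUV
    have hge : ∀ i, 3 ≤ (side U k a b c i).card := fun i => by
      have f := isFace_side (V := V) (k := k) ha hb hc hab hbc hac i
      rw [← Finset.card_eq_three.2 ⟨a, b, c, hab.ne, hac.ne, hbc.ne, rfl⟩]
      refine Finset.card_le_card fun u hu => ?_
      simp only [Finset.mem_insert, Finset.mem_singleton] at hu
      rcases hu with rfl | rfl | rfl
      exacts [f.mem₁, f.mem₂, f.mem₃]
    have hsmall : ∀ i, (side V k a b c i).card ≤ (side U k a b c i).card + 1 := fun i => by
      have h₁ : side V k a b c i \ side U k a b c i ⊆ V \ U := by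
        intro u
        simp only [side, Finset.mem_sdiff, Finset.mem_filter]
        tauto
      have h₁ := Finset.card_le_card h₁
      rw [Finset.card_sdiff_of_subset hUV, Finset.card_sdiff_of_subset (hsub i)] at h₁
      omega
    have b₀ := ih _ lt₀ (h.mono (side_subset U k a b c 0)) (hsub 0) (hge 0) (hsmall 0) rfl
    have b₁ := ih _ lt₁ (h.mono (side_subset U k a b c 1)) (hsub 1) (hge 1) (hsmall 1) rfl
    have hmem : ∀ i, {a, b, c} ∈ faces (side V k a b c i) (side U k a b c i) G k :=
      fun i => mem_faces.2 ⟨a, b, c, rfl, isFace_side ha hb hc hab hbc hac i⟩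
    have hcover : faces V U G k ⊆
        (faces (side V k a b c 0) (side U k a b c 0) G k).erase {a, b, c} ∪
          (faces (side V k a b c 1) (side U k a b c 1) G k).erase {a, b, c} := by
      intro t ht
      have htne : t ≠ {a, b, c} := by
        rintro rfl
        exact hnot (isFace_of_mem_faces h hab.ne ht)
      obtain ⟨i, hi⟩ := faces_subset_sides h ha hb hc hab hbc hac ht
      have d : ∀ i : ZMod 2, i = 0 ∨ i = 1 := by decide
      rw [Finset.mem_union, Finset.mem_erase, Finset.mem_erase]
      rcases d i with rfl | rfl
      · exact Or.inl ⟨htne, hi⟩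
      · exact Or.inr ⟨htne, hi⟩
    have hcard := (Finset.card_le_card hcover).trans (Finset.card_union_le _ _)
    rw [Finset.card_erase_of_mem (hmem 0), Finset.card_erase_of_mem (hmem 1)] at hcard
    have p₀ := Finset.card_pos.2 ⟨_, hmem 0⟩
    have p₁ := Finset.card_pos.2 ⟨_, hmem 1⟩
    omega

/-- If no triangle of `T` winds around any point, then a further point seeing no winding at all
can be added. -/
theorem card_add_five_le (h : WindingParity U G k ε) (hU : 3 ≤ U.card)
    {T : Finset (Finset α)} [DecidableEq α]
    (hT : ∀ t ∈ T, ∃ a b c, t = {a, b, c} ∧ (a ∈ U ∧ b ∈ U ∧ c ∈ U) ∧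
      (G.Adj a b ∧ G.Adj b c ∧ G.Adj a c) ∧
      ∀ v ∈ U, v ≠ a → v ≠ b → v ≠ c → around k v a b c = 0) :
    T.card + 5 ≤ 2 * U.card := by
  let k' : Option α → Option α → Option α → ZMod 2 := fun v x y =>
    v.elim 0 fun v => x.elim 0 fun x => y.elim 0 fun y => k v x y
  let ε' : Option α → Option α → ZMod 2 := fun x y => x.elim 0 fun x => y.elim 0 fun y => ε x y
  have h' : WindingParity (U.map .some) (G.map Function.Embedding.some) k' ε' := by
    constructor
    · rintro (_ | v) (_ | x) (_ | y) <;> first | rfl | exact h.symm v x y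
    · intro x hx y hy hxy
      obtain ⟨x, hx', rfl⟩ := Finset.mem_map.1 hx
      obtain ⟨y, hy', rfl⟩ := Finset.mem_map.1 hy
      exact h.tournament x hx' y hy' fun e => hxy (e ▸ rfl)
    · intro x hx y hy u hu v hv hxy huv h₁ h₂ h₃ h₄
      obtain ⟨x, hx', rfl⟩ := Finset.mem_map.1 hx
      obtain ⟨y, hy', rfl⟩ := Finset.mem_map.1 hy
      obtain ⟨u, hu', rfl⟩ := Finset.mem_map.1 hu
      obtain ⟨v, hv', rfl⟩ := Finset.mem_map.1 hv
      rw [SimpleGraph.map_adj_apply] at hxy huv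
      exact h.exchange x hx' y hy' u hu' v hv' hxy huv (fun e => h₁ (e ▸ rfl))
        (fun e => h₂ (e ▸ rfl)) (fun e => h₃ (e ▸ rfl)) (fun e => h₄ (e ▸ rfl))
  have hcard : (insert none (U.map Function.Embedding.some)).card = U.card + 1 := by
    rw [Finset.card_insert_of_notMem (by simp), Finset.card_map]
  have hle := h'.card_faces_le (V := insert none (U.map Function.Embedding.some))
    (Finset.subset_insert _ _) (by rwa [Finset.card_map]) (by rw [hcard, Finset.card_map])
  have hTle : T.card ≤ (faces (insert none (U.map Function.Embedding.some)) (U.map .some)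
      (G.map Function.Embedding.some) k').card := by
    refine Finset.card_le_card_of_injOn (Finset.map .some) ?_
      (Finset.map_injective _).injOn
    intro t ht
    obtain ⟨a, b, c, rfl, ⟨ha, hb, hc⟩, ⟨hab, hbc, hac⟩, h₀⟩ := hT t ht
    have key : ∀ v ∈ insert none (U.map Function.Embedding.some), v ≠ some a → v ≠ some b →
        v ≠ some c → around k' v (some a) (some b) (some c) = 0 := by
      rintro (_ | v) hv h₁ h₂ h₃
      · simp [around, k']
      · exact h₀ v (by simpa using hv) (fun e => h₁ (e ▸ rfl)) (fun e => h₂ (e ▸ rfl))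
          (fun e => h₃ (e ▸ rfl))
    refine mem_faces.2 ⟨some a, some b, some c, ?_, ⟨by simpa, by simpa, by simpa,
      SimpleGraph.map_adj_apply.2 hab, SimpleGraph.map_adj_apply.2 hbc,
      SimpleGraph.map_adj_apply.2 hac, ?_⟩⟩
    · ext; simp
    · intro v hv w hw h₁ h₂ h₃ h₄ h₅ h₆
      rw [key v hv h₁ h₂ h₃, key w hw h₄ h₅ h₆]
  rw [hcard, Finset.card_map] at hle
  omega

end WindingParity

namespace Complex

theorem exists_continuous_log {X : Type*} [TopologicalSpace X] [LocallyPathConnectedSpace X]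
    [SimplyConnectedSpace X] {F : X → ℂ} (hF : Continuous F) (h0 : ∀ x, F x ≠ 0) :
    ∃ l : X → ℂ, Continuous l ∧ ∀ x, exp (l x) = F x := by
  obtain ⟨l, hl, he⟩ := exists_continuousOn_eqOn_exp_comp (U := Set.univ) (g := F)
    (Homeomorph.Set.univ X).toHomotopyEquiv.simplyConnectedSpace isOpen_univ hF.continuousOn
    (by simpa using h0)
  exact ⟨l, continuousOn_univ.1 hl, fun x => he (Set.mem_univ x)⟩

open Classical in
/-- The variation along `[0, 1]` of a continuous logarithm of `H`. -/
noncomputable def logVar (H : ℝ → ℂ) : ℂ :=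
  if h : ∃ l : ℝ → ℂ, Continuous l ∧ ∀ t, exp (l t) = H t then h.choose 1 - h.choose 0 else 0

theorem logVar_eq {H l : ℝ → ℂ} (hl : Continuous l) (he : ∀ t, exp (l t) = H t) :
    logVar H = l 1 - l 0 := by
  have h : ∃ l : ℝ → ℂ, Continuous l ∧ ∀ t, exp (l t) = H t := ⟨l, hl, he⟩
  rw [logVar, dif_pos h]
  obtain ⟨hm, hme⟩ := h.choose_spec
  set m := h.choose
  have := isCoveringMap_exp.eq_of_comp_eq (g₁ := fun t => l t + (m 0 - l 0)) (g₂ := m)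
    (by fun_prop) hm ?_ 0 (by ring)
  · have h1 := congrFun this 1
    rw [← h1]; ring
  · ext t
    simp only [Function.comp_apply, exp_add, exp_sub, he, hme]
    field_simp [show H 0 ≠ 0 from he 0 ▸ exp_ne_zero _]

theorem exp_logVar {H : ℝ → ℂ} (hH : Continuous H) (h0 : ∀ t, H t ≠ 0) :
    exp (logVar H) = H 1 / H 0 := by
  obtain ⟨l, hl, he⟩ := exists_continuous_log hH h0
  rw [logVar_eq hl he, exp_sub, he, he]

theorem logVar_neg {H : ℝ → ℂ} (hH : Continuous H) (h0 : ∀ t, H t ≠ 0) :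
    logVar (fun t => -H t) = logVar H := by
  obtain ⟨l, hl, he⟩ := exists_continuous_log hH h0
  rw [logVar_eq hl he, logVar_eq (l := fun t => l t + Real.pi * I) (by fun_prop)
    (by intro t; rw [exp_add, he, exp_pi_mul_I]; ring)]
  ring

theorem logVar_const {c : ℂ} (hc : c ≠ 0) : logVar (fun _ => c) = 0 := by
  rw [logVar_eq (l := fun _ => log c) (by fun_prop) (fun _ => exp_log hc), sub_self]

theorem logVar_reverse {H : ℝ → ℂ} (hH : Continuous H) (h0 : ∀ t, H t ≠ 0) :
    logVar (fun t => H (1 - t)) = -logVar H := by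
  obtain ⟨l, hl, he⟩ := exists_continuous_log hH h0
  rw [logVar_eq hl he, logVar_eq (l := fun t => l (1 - t)) (by fun_prop) (fun t => he _)]
  simp

theorem logVar_square {F : ℝ × ℝ → ℂ} (hF : Continuous F) (h0 : ∀ p, F p ≠ 0) :
    logVar (fun t => F (t, 0)) + logVar (fun t => F (1, t)) =
      logVar (fun t => F (0, t)) + logVar (fun t => F (t, 1)) := by
  obtain ⟨l, hl, he⟩ := exists_continuous_log hF h0
  rw [logVar_eq (l := fun t => l (t, 0)) (by fun_prop) (fun t => he _),
    logVar_eq (l := fun t => l (1, t)) (by fun_prop) (fun t => he _),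
    logVar_eq (l := fun t => l (0, t)) (by fun_prop) (fun t => he _),
    logVar_eq (l := fun t => l (t, 1)) (by fun_prop) (fun t => he _)]
  ring

end Complex

namespace WindingParity

/-- The point with barycentric parameter `t`, clamped to `[0, 1]`, on the segment from `p`
to `q`. -/
noncomputable def clampedLine {E : Type*} [AddCommGroup E] [Module ℝ E] (p q : E) (t : ℝ) : E :=
  AffineMap.lineMap p q (max 0 (min 1 t))

section ClampedLine

variable {E : Type*} [AddCommGroup E] [Module ℝ E] (p q : E)

@[simp] theorem clampedLine_zero : clampedLine p q 0 = p := by simp [clampedLine]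

@[simp] theorem clampedLine_one : clampedLine p q 1 = q := by simp [clampedLine]

theorem clampedLine_one_sub (t : ℝ) : clampedLine p q (1 - t) = clampedLine q p t := by
  have : max 0 (min 1 (1 - t)) = 1 - max 0 (min 1 t) := by grind
  rw [clampedLine, this, AffineMap.lineMap_apply_one_sub, clampedLine]

theorem clampedLine_mem_segment (t : ℝ) : clampedLine p q t ∈ segment ℝ p q := by
  rw [segment_eq_image_lineMap]
  exact ⟨_, ⟨le_max_left _ _, max_le zero_le_one (min_le_left _ _)⟩, rfl⟩

end ClampedLine

theorem continuous_clampedLine {X E : Type*} [TopologicalSpace X] [AddCommGroup E] [Module ℝ E]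
    [TopologicalSpace E] [IsTopologicalAddGroup E] [ContinuousSMul ℝ E] {p q : X → E} {t : X → ℝ}
    (hp : Continuous p) (hq : Continuous q) (ht : Continuous t) :
    Continuous fun x => clampedLine (p x) (q x) (t x) := by
  simp only [clampedLine, AffineMap.lineMap_apply_module]
  fun_prop

/-- The vertex of the polyhedron corresponding to `i`. -/
def vertex {n : ℕ} (i : Fin n) : Fin n → ℝ := Pi.single i 1

/-- The geometric simplex spanned by `F`. -/
def simplex {n : ℕ} (F : Finset (Fin n)) : Set (Fin n → ℝ) :=
  convexHull ℝ (vertex '' (F : Set (Fin n)))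

section Polyhedron

variable {n : ℕ} {K : Finset (Finset (Fin n))} {g : (Fin n → ℝ) → ℂ}

theorem simplex_subset {F : Finset (Fin n)} (hF : F ∈ K) : simplex F ⊆ polyhedron n K :=
  Set.subset_biUnion_of_mem (u := fun F : Finset (Fin n) => simplex F) hF

theorem vertex_mem_simplex {F : Finset (Fin n)} {i : Fin n} (hi : i ∈ F) : vertex i ∈ simplex F :=
  subset_convexHull ℝ _ ⟨i, hi, rfl⟩

theorem clampedLine_mem_simplex {F : Finset (Fin n)} {p q : Fin n → ℝ} (hp : p ∈ simplex F)
    (hq : q ∈ simplex F) (t : ℝ) : clampedLine p q t ∈ simplex F :=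
  (convex_convexHull ℝ _).segment_subset hp hq (clampedLine_mem_segment p q t)

theorem disjoint_simplex {F F' : Finset (Fin n)} (h : Disjoint F F') :
    Disjoint (simplex F) (simplex F') := by
  have h₁ : simplex F ⊆ {p | ∑ i ∈ F, p i = 1} := by
    refine convexHull_min ?_ ?_
    · rintro _ ⟨i, hi, rfl⟩
      simpa [vertex, Pi.single_apply] using hi
    · intro p hp q hq a b _ _ hab
      simp only [Set.mem_ofPred_eq] at hp hq ⊢
      simp [Finset.sum_add_distrib, ← Finset.mul_sum, hp, hq, hab]
  have h₂ : simplex F' ⊆ {p | ∑ i ∈ F, p i = 0} := by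
    refine convexHull_min ?_ ?_
    · rintro _ ⟨i, hi, rfl⟩
      simpa [vertex, Pi.single_apply] using Finset.disjoint_right.1 h hi
    · intro p hp q hq a b _ _ hab
      simp only [Set.mem_ofPred_eq] at hp hq ⊢
      simp [Finset.sum_add_distrib, ← Finset.mul_sum, hp, hq]
  refine Set.disjoint_left.2 fun p hp hp' => ?_
  have e₁ := h₁ hp
  have e₂ := h₂ hp'
  simp only [Set.mem_ofPred_eq] at e₁ e₂
  exact zero_ne_one (e₂.symm.trans e₁)

theorem sub_ne_zero_of_disjoint (hg : Set.InjOn g (polyhedron n K)) {F F' : Finset (Fin n)}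
    (hF : F ∈ K) (hF' : F' ∈ K) (h : Disjoint F F') {p q : Fin n → ℝ} (hp : p ∈ simplex F)
    (hq : q ∈ simplex F') : g p - g q ≠ 0 := fun e =>
  Set.disjoint_left.1 (disjoint_simplex h) hp
    (hg (simplex_subset hF hp) (simplex_subset hF' hq) (sub_eq_zero.1 e) ▸ hq)

/-- The variation of `log (g v - g p)` as `p` runs along the edge from `x` to `y`. -/
noncomputable def edgeVar (g : (Fin n → ℝ) → ℂ) (v x y : Fin n) : ℂ :=
  Complex.logVar fun t => g (vertex v) - g (clampedLine (vertex x) (vertex y) t)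

theorem edge_mem {x y : Fin n} (t : ℝ) :
    clampedLine (vertex x) (vertex y) t ∈ simplex {x, y} :=
  clampedLine_mem_simplex (vertex_mem_simplex (by simp)) (vertex_mem_simplex (by simp)) t

theorem continuous_edge (hc : ContinuousOn g (polyhedron n K))
    {x y : Fin n} (hxy : {x, y} ∈ K) :
    Continuous fun t => g (clampedLine (vertex x) (vertex y) t) :=
  hc.comp_continuous (continuous_clampedLine (by fun_prop) (by fun_prop) (by fun_prop))
    fun t => simplex_subset hxy (edge_mem t)

theorem continuous_sub_edge (hc : ContinuousOn g (polyhedron n K))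
    {x y : Fin n} (hxy : {x, y} ∈ K) (c : ℂ) :
    Continuous fun t => c - g (clampedLine (vertex x) (vertex y) t) :=
  continuous_const.sub (continuous_edge hc hxy)

theorem edge_ne (hg : Set.InjOn g (polyhedron n K))
    {v x y : Fin n} (hv : {v} ∈ K) (hxy : {x, y} ∈ K) (hvx : v ≠ x) (hvy : v ≠ y)
    (t : ℝ) : g (vertex v) - g (clampedLine (vertex x) (vertex y) t) ≠ 0 :=
  sub_ne_zero_of_disjoint hg hv hxy (by simp [hvx, hvy]) (vertex_mem_simplex (by simp))
    (edge_mem t)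

theorem exp_edgeVar (hc : ContinuousOn g (polyhedron n K))
    (hg : Set.InjOn g (polyhedron n K)) {v x y : Fin n} (hv : {v} ∈ K)
    (hxy : {x, y} ∈ K) (hvx : v ≠ x) (hvy : v ≠ y) : Complex.exp (edgeVar g v x y) =
      (g (vertex v) - g (vertex y)) / (g (vertex v) - g (vertex x)) := by
  rw [edgeVar, Complex.exp_logVar (continuous_sub_edge hc hxy _)
    (edge_ne hg hv hxy hvx hvy)]
  simp

theorem edgeVar_swap (hc : ContinuousOn g (polyhedron n K))
    (hg : Set.InjOn g (polyhedron n K)) {v x y : Fin n} (hv : {v} ∈ K)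
    (hxy : {x, y} ∈ K) (hvx : v ≠ x) (hvy : v ≠ y) : edgeVar g v y x = -edgeVar g v x y := by
  rw [edgeVar, edgeVar, ← Complex.logVar_reverse
    (continuous_sub_edge hc hxy _) (edge_ne hg hv hxy hvx hvy)]
  simp only [clampedLine_one_sub]

theorem edgeVar_triangle (hc : ContinuousOn g (polyhedron n K))
    (hg : Set.InjOn g (polyhedron n K)) {v x y z : Fin n} (hv : {v} ∈ K) (hxyz : {x, y, z} ∈ K)
    (hvx : v ≠ x) (hvy : v ≠ y) (hvz : v ≠ z) :
    edgeVar g v x y + edgeVar g v y z = edgeVar g v x z := by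
  have hmem : ∀ p : ℝ × ℝ, clampedLine (vertex x) (clampedLine (vertex y) (vertex z) p.2) p.1 ∈
      simplex {x, y, z} := fun p =>
    clampedLine_mem_simplex (vertex_mem_simplex (by simp)) (clampedLine_mem_simplex
      (vertex_mem_simplex (by simp)) (vertex_mem_simplex (by simp)) _) _
  have hcont : Continuous fun p : ℝ × ℝ => g (vertex v) -
      g (clampedLine (vertex x) (clampedLine (vertex y) (vertex z) p.2) p.1) :=
    continuous_const.sub (hc.comp_continuous (continuous_clampedLine (by fun_prop)
      (continuous_clampedLine (by fun_prop) (by fun_prop) (by fun_prop)) (by fun_prop))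
      fun p => simplex_subset hxyz (hmem p))
  have hne : ∀ p : ℝ × ℝ, g (vertex v) -
      g (clampedLine (vertex x) (clampedLine (vertex y) (vertex z) p.2) p.1) ≠ 0 := fun p =>
    sub_ne_zero_of_disjoint hg hv hxyz (by simp [hvx, hvy, hvz])
      (vertex_mem_simplex (by simp)) (hmem p)
  have := Complex.logVar_square hcont hne
  have h0 := hne (0, 0)
  simp only [clampedLine_zero, clampedLine_one] at this h0
  rw [Complex.logVar_const h0, zero_add] at this
  exact this

theorem edgeVar_square (hc : ContinuousOn g (polyhedron n K))
    (hg : Set.InjOn g (polyhedron n K)) {x y u v : Fin n} (hK : ∀ F ∈ K, ∀ G ⊆ F, G ∈ K)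
    (hxy : {x, y} ∈ K) (huv : {u, v} ∈ K)
    (hxu : x ≠ u) (hxv : x ≠ v) (hyu : y ≠ u) (hyv : y ≠ v) :
    edgeVar g u x y + edgeVar g y u v = edgeVar g x u v + edgeVar g v x y := by
  have hcont : Continuous fun p : ℝ × ℝ => g (clampedLine (vertex x) (vertex y) p.1) -
      g (clampedLine (vertex u) (vertex v) p.2) :=
    ((continuous_edge hc hxy).comp continuous_fst).sub
      ((continuous_edge hc huv).comp continuous_snd)
  have hne : ∀ p : ℝ × ℝ, g (clampedLine (vertex x) (vertex y) p.1) -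
      g (clampedLine (vertex u) (vertex v) p.2) ≠ 0 := fun p =>
    sub_ne_zero_of_disjoint hg hxy huv (by simp [hxu.symm, hxv.symm, hyu.symm, hyv.symm]) (edge_mem _) (edge_mem _)
  have := Complex.logVar_square hcont hne
  simp only [clampedLine_zero, clampedLine_one] at this
  have hu : {u} ∈ K := hK _ huv _ (by simp)
  have hv : {v} ∈ K := hK _ huv _ (by simp)
  have e : ∀ w, {w} ∈ K → x ≠ w → y ≠ w →
      Complex.logVar (fun t => g (clampedLine (vertex x) (vertex y) t) - g (vertex w)) =
        edgeVar g w x y := fun w hw h₁ h₂ => by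
    rw [edgeVar, ← Complex.logVar_neg (continuous_sub_edge hc hxy _)
      (edge_ne hg hw hxy h₁.symm h₂.symm)]
    simp only [neg_sub]
  rw [e u hu hxu hyu, e v hv hxv hyv] at this
  exact this

theorem exists_windingParity (hc : ContinuousOn g (polyhedron n K))
    (hg : Set.InjOn g (polyhedron n K)) (hK : ∀ F ∈ K, ∀ G ⊆ F, G ∈ K) :
    ∃ k ε, WindingParity (Finset.univ.filter fun i : Fin n => {i} ∈ K)
      (SimpleGraph.fromRel fun x y => {x, y} ∈ K) k ε ∧
      ∀ a b c, {a, b, c} ∈ K → ∀ v, {v} ∈ K → v ≠ a → v ≠ b → v ≠ c → around k v a b c = 0 := by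
  have hpi : (Real.pi : ℂ) * Complex.I ≠ 0 :=
    mul_ne_zero (Complex.ofReal_ne_zero.2 Real.pi_ne_zero) Complex.I_ne_zero
  have hvert : ∀ v w : Fin n, {v} ∈ K → {w} ∈ K → v ≠ w → g (vertex v) - g (vertex w) ≠ 0 :=
    fun v w hv hw hvw => sub_ne_zero_of_disjoint hg hv hw (by simpa using hvw)
      (vertex_mem_simplex (by simp)) (vertex_mem_simplex (by simp))
  set L : Fin n → Fin n → ℂ := fun v w => Complex.log (g (vertex v) - g (vertex w)) with hL
  have hexp : ∀ v w : Fin n, {v} ∈ K → {w} ∈ K → v ≠ w →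
      Complex.exp (L v w) = g (vertex v) - g (vertex w) :=
    fun v w hv hw hvw => Complex.exp_log (hvert v w hv hw hvw)
  have hE : ∀ v w : Fin n, ∃ m : ℤ, {v} ∈ K → {w} ∈ K → v ≠ w →
      L v w = L w v + (2 * m + 1) * (Real.pi * Complex.I) := by
    intro v w
    by_cases h : {v} ∈ K ∧ {w} ∈ K ∧ v ≠ w
    · have : Complex.exp (L v w) = Complex.exp (L w v + Real.pi * Complex.I) := by
        rw [Complex.exp_add, hexp _ _ h.1 h.2.1 h.2.2, hexp _ _ h.2.1 h.1 h.2.2.symm,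
          Complex.exp_pi_mul_I]
        ring
      obtain ⟨m, hm⟩ := Complex.exp_eq_exp_iff_exists_int.1 this
      exact ⟨m, fun _ _ _ => by rw [hm]; ring⟩
    · exact ⟨0, fun h₁ h₂ h₃ => absurd ⟨h₁, h₂, h₃⟩ h⟩
  choose E hE using hE
  have hW : ∀ v x y : Fin n, ∃ m : ℤ, {v} ∈ K → {x, y} ∈ K → v ≠ x → v ≠ y →
      edgeVar g v x y = L v y - L v x + 2 * m * (Real.pi * Complex.I) := by
    intro v x y
    by_cases h : {v} ∈ K ∧ {x, y} ∈ K ∧ v ≠ x ∧ v ≠ y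
    · have : Complex.exp (edgeVar g v x y) = Complex.exp (L v y - L v x) := by
        rw [Complex.exp_sub, exp_edgeVar hc hg h.1 h.2.1 h.2.2.1 h.2.2.2,
          hexp _ _ h.1 (hK _ h.2.1 _ (by simp)) h.2.2.2,
          hexp _ _ h.1 (hK _ h.2.1 _ (by simp)) h.2.2.1]
      obtain ⟨m, hm⟩ := Complex.exp_eq_exp_iff_exists_int.1 this
      exact ⟨m, fun _ _ _ _ => by rw [hm]; ring⟩
    · exact ⟨0, fun h₁ h₂ h₃ h₄ => absurd ⟨h₁, h₂, h₃, h₄⟩ h⟩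
  choose W hW using hW
  have hswap : ∀ v x y : Fin n, {v} ∈ K → {x, y} ∈ K → v ≠ x → v ≠ y →
      (W v y x : ZMod 2) = W v x y := by
    intro v x y hv hxy hvx hvy
    have e := edgeVar_swap hc hg hv hxy hvx hvy
    rw [hW v x y hv hxy hvx hvy, hW v y x hv (by rwa [Finset.pair_comm]) hvy hvx] at e
    have : (W v y x : ℂ) = -W v x y := by
      refine mul_right_cancel₀ hpi ?_
      linear_combination e / 2
    have : W v y x = -W v x y := by exact_mod_cast this
    rw [this, Int.cast_neg, ZMod.neg_eq_self_mod_two]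
  set k : Fin n → Fin n → Fin n → ZMod 2 := fun v x y => if x < y then W v x y else W v y x with hk
  have hkW : ∀ v x y : Fin n, {v} ∈ K → {x, y} ∈ K → v ≠ x → v ≠ y → k v x y = W v x y := by
    intro v x y hv hxy hvx hvy
    simp only [hk]
    split_ifs
    · rfl
    · exact hswap v x y hv hxy hvx hvy
  refine ⟨k, fun x y => (E x y : ZMod 2), ⟨?_, ?_, ?_⟩, ?_⟩
  · intro v x y
    simp only [hk]
    rcases lt_trichotomy x y with h | rfl | h
    · rw [if_pos h, if_neg h.not_gt]
    · rfl
    · rw [if_neg h.not_gt, if_pos h]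
  · intro x hx y hy hxy
    simp only [Finset.mem_filter, Finset.mem_univ, true_and] at hx hy
    have e₁ := hE x y hx hy hxy
    have e₂ := hE y x hy hx hxy.symm
    have : (E x y : ℂ) + E y x = -1 := by
      refine mul_right_cancel₀ hpi ?_
      linear_combination (-e₁ - e₂) / 2
    have : E x y + E y x = -1 := by exact_mod_cast this
    rw [← Int.cast_add, this]
    rfl
  · intro x hx y hy u hu v hv hxy huv hxu hxv hyu hyv
    simp only [Finset.mem_filter, Finset.mem_univ, true_and] at hx hy hu hv
    have hadj : ∀ a b : Fin n, (SimpleGraph.fromRel fun x y : Fin n => {x, y} ∈ K).Adj a b →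
        {a, b} ∈ K := by
      intro a b h
      rw [SimpleGraph.fromRel_adj] at h
      rcases h.2 with h | h
      · exact h
      · rwa [Finset.pair_comm]
    have hxy := hadj _ _ hxy
    have huv := hadj _ _ huv
    rw [hkW x u v hx huv hxu hxv, hkW y u v hy huv hyu hyv, hkW u x y hu hxy hxu.symm hyu.symm,
      hkW v x y hv hxy hxv.symm hyv.symm]
    have e := edgeVar_square hc hg hK hxy huv hxu hxv hyu hyv
    rw [hW x u v hx huv hxu hxv, hW y u v hy huv hyu hyv, hW u x y hu hxy hxu.symm hyu.symm,
      hW v x y hv hxy hxv.symm hyv.symm] at e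
    have e₁ := hE x u hx hu hxu
    have e₂ := hE x v hx hv hxv
    have e₃ := hE y u hy hu hyu
    have e₄ := hE y v hy hv hyv
    have : (W x u v : ℂ) + W v x y - W u x y - W y u v = E x u - E x v - E y u + E y v := by
      refine mul_right_cancel₀ hpi ?_
      linear_combination (-e + e₁ - e₂ - e₃ + e₄) / 2
    have : W x u v + W v x y - W u x y - W y u v = E x u - E x v - E y u + E y v := by
      exact_mod_cast this
    have := congrArg (Int.cast : ℤ → ZMod 2) this
    push_cast at this
    grind
  · intro a b c habc v hv hva hvb hvc
    have hab : {a, b} ∈ K := hK _ habc _ (by grind)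
    have hbc : {b, c} ∈ K := hK _ habc _ (by grind)
    have hac : {a, c} ∈ K := hK _ habc _ (by grind)
    have e := edgeVar_triangle hc hg hv habc hva hvb hvc
    rw [hW v a b hv hab hva hvb, hW v b c hv hbc hvb hvc, hW v a c hv hac hva hvc] at e
    have : (W v a b : ℂ) + W v b c = W v a c := by
      refine mul_right_cancel₀ hpi ?_
      linear_combination e / 2
    have : W v a b + W v b c = W v a c := by exact_mod_cast this
    have := congrArg (Int.cast : ℤ → ZMod 2) this
    push_cast at this
    rw [around, hkW v a b hv hab hva hvb, hkW v b c hv hbc hvb hvc, hkW v a c hv hac hva hvc]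
    grind

end Polyhedron

end WindingParity

/-- A 2-dimensional simplicial complex on n ≥ 3 vertices that embeds
topologically into ℝ² has at most 2n - 5 two-dimensional simplices. -/
theorem stmt_3 (n : ℕ) (hn : 3 ≤ n) (K : Finset (Finset (Fin n)))
    (hne : K.Nonempty)
    (hdown : ∀ F ∈ K, ∀ G ⊆ F, G ∈ K)
    (hdim : ∀ F ∈ K, F.card ≤ 3)
    (hdim' : ∃ F ∈ K, F.card = 3)
    (hemb : ∃ f : polyhedron n K → (Fin 2 → ℝ), Continuous f ∧ Function.Injective f) :
    (K.filter fun F => F.card = 3).card ≤ 2 * n - 5 := by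
  classical
  obtain ⟨f, hf, hinj⟩ := hemb
  let f' : polyhedron n K → ℂ := fun p => Complex.equivRealProdCLM.symm (f p 0, f p 1)
  have hf' : Continuous f' := by fun_prop
  have hinj' : Function.Injective f' := by
    intro p q h
    have h := Complex.equivRealProdCLM.symm.injective h
    refine hinj (funext fun i => ?_)
    fin_cases i
    exacts [congrArg Prod.fst h, congrArg Prod.snd h]
  let g : (Fin n → ℝ) → ℂ := fun p => if h : p ∈ polyhedron n K then f' ⟨p, h⟩ else 0
  have hgf : ∀ p : polyhedron n K, g p = f' p := fun p => dif_pos p.2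
  have hc : ContinuousOn g (polyhedron n K) := by
    rw [continuousOn_iff_continuous_domRestrict]
    exact hf'.congr fun p => (hgf p).symm
  have hg : Set.InjOn g (polyhedron n K) := by
    intro p hp q hq h
    rw [hgf ⟨p, hp⟩, hgf ⟨q, hq⟩] at h
    exact congrArg Subtype.val (hinj' h)
  obtain ⟨k, ε, hwp, htri⟩ := WindingParity.exists_windingParity hc hg hdown
  have hmem : ∀ F ∈ K, ∀ i ∈ F, {i} ∈ K := fun F hF i hi => hdown F hF _ (by simpa using hi)
  have hU : 3 ≤ (Finset.univ.filter fun i : Fin n => {i} ∈ K).card := by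
    obtain ⟨F, hF, hcard⟩ := hdim'
    rw [← hcard]
    exact Finset.card_le_card fun i hi => by simpa using hmem F hF i hi
  have hle : (Finset.univ.filter fun i : Fin n => {i} ∈ K).card ≤ n :=
    (Finset.card_le_univ _).trans_eq (Fintype.card_fin n)
  have := hwp.card_add_five_le (T := K.filter fun F => F.card = 3) hU ?_
  · omega
  · intro t ht
    rw [Finset.mem_filter] at ht
    obtain ⟨a, b, c, hab, hac, hbc, rfl⟩ := Finset.card_eq_three.1 ht.2
    have hm := hmem _ ht.1
    refine ⟨a, b, c, rfl, ?_, ?_, ?_⟩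
    · simpa using hm
    · simp only [SimpleGraph.fromRel_adj]
      exact ⟨⟨hab, .inl (hdown _ ht.1 _ (by grind))⟩, ⟨hbc, .inl (hdown _ ht.1 _ (by grind))⟩,
        ⟨hac, .inl (hdown _ ht.1 _ (by grind))⟩⟩
    · intro v hv
      exact htri a b c ht.1 v (by simpa using hv)
end

section
/- Let L be the simplicial complex on vertex set [9] = {1,…,9} whose simplices are all subsets of [9] of cardinality at most 3 except the nine 3-sets {2,4,6}, {2,4,7}, {2,5,7}, {2,5,8}, {2,6,8}, {3,5,7}, {3,5,8}, {3,6,8}, {4,6,8} (this complex is the 2-skeleton of the boundary of the cyclic 5-polytope on 9 vertices together with its missing 2-face {2,4,8}). Then L contains no copy of any of the three complexes (Δ_2^{≤0})^{*3}, Δ_4^{≤1} * Δ_2^{≤0}, and Δ_6^{≤2} as a subcomplex. -/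
/-- The nine forbidden triples (all missing 2-faces of C₅(9) other than {2,4,8}). -/
def badTriples : Finset (Finset ℕ) :=
  {{2, 4, 6}, {2, 4, 7}, {2, 5, 7}, {2, 5, 8}, {2, 6, 8},
   {3, 5, 7}, {3, 5, 8}, {3, 6, 8}, {4, 6, 8}}

/-- L: all subsets of [9] of cardinality at most 3 except the nine bad triples.
This is the 2-skeleton of ∂C₅(9) together with the missing 2-face {2,4,8}. -/
def Lcomplex : Finset (Finset ℕ) :=
  (Finset.Icc 1 9).powerset.filter fun F => F.card ≤ 3 ∧ F ∉ badTriples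

/-- `L` (with vertex set `VL`) contains a copy of the complex `X` as a subcomplex:
an injective map of the vertex set of `X` into `VL` carrying simplices to simplices. -/
def HasCopy {α : Type} [DecidableEq α] (X : Finset (Finset α)) (VL : Finset ℕ)
    (L : Finset (Finset ℕ)) : Prop :=
  ∃ φ : α → ℕ, Function.Injective φ ∧ (∀ a, φ a ∈ VL) ∧ ∀ F ∈ X, F.image φ ∈ L

/-- (Δ₂^{≤0})^{*3}: simplices are the subsets of a 3 × 3 vertex set meeting each
of the three parts in at most one vertex. -/
def X1 : Finset (Finset (Fin 3 × Fin 3)) :=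
  Finset.univ.powerset.filter fun F => ∀ i : Fin 3, (F.filter fun p => p.1 = i).card ≤ 1

/-- Δ₄^{≤1} * Δ₂^{≤0}: simplices are subsets of a (5 + 3)-element vertex set with
at most 2 vertices in the 5-part and at most 1 vertex in the 3-part. -/
def X2 : Finset (Finset (Fin 5 ⊕ Fin 3)) :=
  Finset.univ.powerset.filter fun F =>
    (F.filter fun v => v.isLeft = true).card ≤ 2 ∧ (F.filter fun v => v.isRight = true).card ≤ 1

/-- Δ₆^{≤2}: all subsets of cardinality at most 3 of a 7-element vertex set. -/
def X3 : Finset (Finset (Fin 7)) :=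
  Finset.univ.powerset.filter fun F => F.card ≤ 3

/-- A copy of `X` induces a partial colouring of the vertices of `L` from any colouring `κ` of the
vertices of `X`: uncovered vertices get `none`. Colour classes do not grow, and a missing triple of
`L` with all vertices covered comes from a missing triple of `X` with the same colours. -/
theorem HasCopy.exists_coloring {α β : Type} [DecidableEq α] [Fintype α] [DecidableEq β]
    {X : Finset (Finset α)} {VL : Finset ℕ} {L : Finset (Finset ℕ)}
    (h : HasCopy X VL L) (κ : α → β) :
    ∃ c : ℕ → Option β,
      (∀ l : List ℕ, l.Nodup → l.toFinset ⊆ VL →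
        (∀ k, (l.map c).count (some k) ≤ (Finset.univ.filter fun a => κ a = k).card) ∧
        (l.map c).count none ≤ VL.card - Fintype.card α) ∧
      ∀ x y z : ℕ, ({x, y, z} : Finset ℕ) ∉ L → ∀ i j k : β,
        c x = some i → c y = some j → c z = some k →
        ∃ a b d : α, κ a = i ∧ κ b = j ∧ κ d = k ∧ ({a, b, d} : Finset α) ∉ X := by
  classical
  obtain ⟨φ, hφ, hV, hL⟩ := h
  have hg : ∀ a n, Function.partialInv φ n = some a ↔ φ a = n := hφ.isPartialInv
  have hcount : ∀ (l : List ℕ) (c : ℕ → Option β) (o : Option β), l.Nodup →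
      (l.map c).count o = (l.toFinset.filter fun n => c n = o).card := by
    intro l c o hl
    have hf : l.toFinset.filter (fun n => c n = o) = (l.filter fun n => c n == o).toFinset := by
      ext
      simp
    rw [hf, List.toFinset_card_of_nodup (hl.filter _), List.count, List.countP_map,
      List.countP_eq_length_filter]
    rfl
  refine ⟨fun n => (Function.partialInv φ n).map κ, fun l hl hlV => ⟨fun k => ?_, ?_⟩, ?_⟩
  · rw [hcount _ _ _ hl, ← Finset.card_image_of_injective _ hφ]
    refine Finset.card_le_card fun n hn => ?_
    obtain ⟨-, hn⟩ := Finset.mem_filter.1 hn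
    obtain ⟨a, ha, rfl⟩ := Option.map_eq_some_iff.1 hn
    exact Finset.mem_image.2 ⟨a, by simp, (hg _ _).1 ha⟩
  · rw [hcount _ _ _ hl, ← Finset.card_univ, ← Finset.card_image_of_injective _ hφ,
      ← Finset.card_sdiff_of_subset (by simpa [Finset.subset_iff] using hV)]
    refine Finset.card_le_card fun n hn => ?_
    obtain ⟨hnl, hn⟩ := Finset.mem_filter.1 hn
    refine Finset.mem_sdiff.2 ⟨hlV hnl, fun hmem => ?_⟩
    obtain ⟨a, -, ha⟩ := Finset.mem_image.1 hmem
    rw [(hg a n).2 ha] at hn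
    exact Option.some_ne_none _ hn
  · intro x y z hxyz i j k hx hy hz
    obtain ⟨a, ha, rfl⟩ := Option.map_eq_some_iff.1 hx
    obtain ⟨b, hb, rfl⟩ := Option.map_eq_some_iff.1 hy
    obtain ⟨d, hd, rfl⟩ := Option.map_eq_some_iff.1 hz
    refine ⟨a, b, d, rfl, rfl, rfl, fun hX => hxyz ?_⟩
    have := hL _ hX
    rwa [Finset.image_insert, Finset.image_insert, Finset.image_singleton, (hg _ _).1 ha,
      (hg _ _).1 hb, (hg _ _).1 hd] at this

theorem not_mem_Lcomplex_of_mem_badTriples {F : Finset ℕ} (hF : F ∈ badTriples) :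
    F ∉ Lcomplex := fun h => (Finset.mem_filter.1 h).2.2 hF

theorem triple_mem_X1 {a b d : Fin 3 × Fin 3} (hab : a.1 ≠ b.1) (had : a.1 ≠ d.1)
    (hbd : b.1 ≠ d.1) : ({a, b, d} : Finset (Fin 3 × Fin 3)) ∈ X1 := by
  simp only [X1, Finset.powerset_univ, Finset.mem_filter, Finset.mem_univ, true_and]
  intro i
  rw [Finset.card_le_one]
  grind

theorem triple_mem_X2 {a b d : Fin 5 ⊕ Fin 3}
    (ht : [a.isLeft, b.isLeft, d.isLeft].count true = 2)
    (hf : [a.isLeft, b.isLeft, d.isLeft].count false = 1) :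
    ({a, b, d} : Finset (Fin 5 ⊕ Fin 3)) ∈ X2 := by
  rcases a with a | a <;> rcases b with b | b <;> rcases d with d | d <;>
    simp_all [X2, Finset.filter_insert, Finset.filter_singleton, Finset.card_le_two]

theorem triple_mem_X3 (a b d : Fin 7) : ({a, b, d} : Finset (Fin 7)) ∈ X3 := by
  simp [X3, Finset.card_le_three]

set_option synthInstance.maxSize 10000 in
/-- In a balanced colouring of the vertices with three colours (`pₙ` being the colour of `n`), some
bad triple is rainbow. -/
theorem exists_rainbow_badTriple : ∀ p2 p4 p6 : Fin 3, ¬ [p2, p4, p6].Nodup →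
    ∀ p8, ¬ [p2, p6, p8].Nodup → ¬ [p4, p6, p8].Nodup →
    ∀ p7, ¬ [p2, p4, p7].Nodup → ∀ p5, ¬ [p2, p5, p7].Nodup → ¬ [p2, p5, p8].Nodup →
    ∀ p3, ¬ [p3, p5, p7].Nodup → ¬ [p3, p5, p8].Nodup → ¬ [p3, p6, p8].Nodup →
    ∃ k, 3 < [p2, p3, p4, p5, p6, p7, p8].count k := by
  decide +kernel

/-- Two of the three colours are `some true` and the other one is `some false`. -/
abbrev IsTwoOne (p q r : Option Bool) : Prop :=
  [p, q, r].count (some true) = 2 ∧ [p, q, r].count (some false) = 1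

set_option synthInstance.maxSize 10000 in
/-- Any partition of the vertices into parts of sizes at most 5, 3 and 1 (colours `some true`,
`some false` and `none`) has a bad triple with two vertices in the first part and one in the
second. -/
theorem exists_two_one_badTriple :
    ∀ p2 p4 p6, ¬ IsTwoOne p2 p4 p6 → ∀ p8, ¬ IsTwoOne p2 p6 p8 → ¬ IsTwoOne p4 p6 p8 →
    ∀ p7, ¬ IsTwoOne p2 p4 p7 → ∀ p5, ¬ IsTwoOne p2 p5 p7 →
    ¬ IsTwoOne p2 p5 p8 → ∀ p3, ¬ IsTwoOne p3 p5 p7 →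
    ¬ IsTwoOne p3 p5 p8 → ¬ IsTwoOne p3 p6 p8 →
    5 < [p2, p3, p4, p5, p6, p7, p8].count (some true) ∨
    3 < [p2, p3, p4, p5, p6, p7, p8].count (some false) ∨
    1 < [p2, p3, p4, p5, p6, p7, p8].count none := by
  decide +kernel

set_option synthInstance.maxSize 10000 in
/-- No two vertices meet all bad triples. -/
theorem two_lt_count_none_of_badTriples : ∀ p2 p4 p6 : Option Unit,
    none ∈ [p2, p4, p6] → ∀ p8, none ∈ [p2, p6, p8] → none ∈ [p4, p6, p8] →
    ∀ p7, none ∈ [p2, p4, p7] → ∀ p5, none ∈ [p2, p5, p7] →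
    none ∈ [p2, p5, p8] → ∀ p3, none ∈ [p3, p5, p7] →
    none ∈ [p3, p5, p8] → none ∈ [p3, p6, p8] →
    2 < [p2, p3, p4, p5, p6, p7, p8].count none := by
  decide +kernel

/-- L contains no copy of (Δ₂^{≤0})^{*3}, of Δ₄^{≤1} * Δ₂^{≤0}, or of Δ₆^{≤2}
as a subcomplex. -/
theorem stmt_7 :
    ¬ HasCopy X1 (Finset.Icc 1 9) Lcomplex ∧
    ¬ HasCopy X2 (Finset.Icc 1 9) Lcomplex ∧
    ¬ HasCopy X3 (Finset.Icc 1 9) Lcomplex := by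
  refine ⟨fun h => ?_, fun h => ?_, fun h => ?_⟩
  · obtain ⟨c, hc, ht⟩ := h.exists_coloring Prod.fst
    have hsome : ∀ n ∈ Finset.Icc 1 9, ∃ i, c n = some i := fun n hn => by
      refine Option.ne_none_iff_exists'.1 fun hn0 => ?_
      have := (hc [n] (by simp) (by simpa using hn)).2
      simp [hn0] at this
    choose! f hf using hsome
    have key : ∀ x y z, x ∈ Finset.Icc 1 9 → y ∈ Finset.Icc 1 9 → z ∈ Finset.Icc 1 9 →
        {x, y, z} ∈ badTriples → ¬ [f x, f y, f z].Nodup := by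
      intro x y z hx hy hz hbad hnd
      obtain ⟨a, b, d, ha, hb, hd, hX⟩ := ht x y z (not_mem_Lcomplex_of_mem_badTriples hbad)
        _ _ _ (hf x hx) (hf y hy) (hf z hz)
      rw [← ha, ← hb, ← hd] at hnd
      simp only [List.nodup_cons, List.mem_cons, not_or, List.not_mem_nil] at hnd
      exact hX (triple_mem_X1 hnd.1.1 hnd.1.2.1 hnd.2.1.1)
    obtain ⟨k, hk⟩ := exists_rainbow_badTriple (f 2) (f 4) (f 6) (by apply key <;> decide)
      (f 8) (by apply key <;> decide) (by apply key <;> decide) (f 7) (by apply key <;> decide)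
      (f 5) (by apply key <;> decide) (by apply key <;> decide) (f 3) (by apply key <;> decide)
      (by apply key <;> decide) (by apply key <;> decide)
    have hle := (hc [2, 3, 4, 5, 6, 7, 8] (by decide) (by decide)).1 k
    have hcard : (Finset.univ.filter fun a : Fin 3 × Fin 3 => a.1 = k).card = 3 := by
      clear hk hle
      revert k
      decide
    have hmap : [2, 3, 4, 5, 6, 7, 8].map c =
        [f 2, f 3, f 4, f 5, f 6, f 7, f 8].map some := by simp [hf]
    rw [hmap, List.count_map_of_injective _ _ (Option.some_injective _)] at hle
    omega
  · obtain ⟨c, hc, ht⟩ := h.exists_coloring Sum.isLeft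
    have key : ∀ x y z, {x, y, z} ∈ badTriples →
        ¬ IsTwoOne (c x) (c y) (c z) := by
      rintro x y z hbad ⟨h2, h1⟩
      have hsome : ∀ p q r : Option Bool, IsTwoOne p q r →
          ∃ i j k, p = some i ∧ q = some j ∧ r = some k := by
        decide
      obtain ⟨i, j, k, hx, hy, hz⟩ := hsome _ _ _ ⟨h2, h1⟩
      obtain ⟨a, b, d, rfl, rfl, rfl, hX⟩ := ht x y z (not_mem_Lcomplex_of_mem_badTriples hbad)
        _ _ _ hx hy hz
      have hmap : [c x, c y, c z] = [a.isLeft, b.isLeft, d.isLeft].map some := by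
        simp [hx, hy, hz]
      rw [hmap, List.count_map_of_injective _ _ (Option.some_injective _)] at h1 h2
      exact hX (triple_mem_X2 h2 h1)
    have hmany := exists_two_one_badTriple (c 2) (c 4) (c 6) (key _ _ _ (by decide))
      (c 8) (key _ _ _ (by decide)) (key _ _ _ (by decide)) (c 7) (key _ _ _ (by decide))
      (c 5) (key _ _ _ (by decide)) (key _ _ _ (by decide)) (c 3) (key _ _ _ (by decide))
      (key _ _ _ (by decide)) (key _ _ _ (by decide))
    obtain ⟨hk, hnone⟩ := hc [2, 3, 4, 5, 6, 7, 8] (by decide) (by decide)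
    rcases hmany with hmany | hmany | hmany
    · exact absurd (hk true) (not_le.2 hmany)
    · exact absurd (hk false) (not_le.2 hmany)
    · exact absurd hnone (not_le.2 hmany)
  · obtain ⟨c, hc, ht⟩ := h.exists_coloring fun _ => ()
    have key : ∀ x y z, {x, y, z} ∈ badTriples → none ∈ [c x, c y, c z] := by
      intro x y z hbad
      by_contra hnone
      simp only [List.mem_cons, List.not_mem_nil, or_false, not_or] at hnone
      obtain ⟨a, b, d, -, -, -, hX⟩ := ht x y z (not_mem_Lcomplex_of_mem_badTriples hbad)
        () () () (Option.ne_none_iff_exists'.1 (Ne.symm hnone.1)).choose_spec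
        (Option.ne_none_iff_exists'.1 (Ne.symm hnone.2.1)).choose_spec
        (Option.ne_none_iff_exists'.1 (Ne.symm hnone.2.2)).choose_spec
      exact hX (triple_mem_X3 a b d)
    have hmany := two_lt_count_none_of_badTriples (c 2) (c 4) (c 6) (key _ _ _ (by decide))
      (c 8) (key _ _ _ (by decide)) (key _ _ _ (by decide)) (c 7) (key _ _ _ (by decide))
      (c 5) (key _ _ _ (by decide)) (key _ _ _ (by decide)) (c 3) (key _ _ _ (by decide))
      (key _ _ _ (by decide)) (key _ _ _ (by decide))
    exact absurd (hc [2, 3, 4, 5, 6, 7, 8] (by decide) (by decide)).2 (not_le.2 hmany)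
end

section
/- For every d ≥ 1 there is N such that for all n ≥ N the following holds: every simplicial complex K of dimension d on n vertices whose polyhedron ‖K‖ admits a topological embedding into ℝ^{2d} satisfies f_d(K) < n^{d+1 − 1/3^d}. In particular, max{ f_d(K) : dim(K) = d, |V(K)| = n, ‖K‖ embeds into ℝ^{2d} } = O(n^{d+1−1/3^d}). -/
section BorsukUlam

open MvPolynomial

theorem exists_algHom_real_of_odd_finrank (A : Type*) [CommRing A] [Algebra ℝ A]
    (hA : Odd (Module.finrank ℝ A)) : Nonempty (A →ₐ[ℝ] ℝ) := by
  induction hk : Module.finrank ℝ A using Nat.strong_induction_on generalizing A with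
  | _ k ih =>
  have hpos : 0 < Module.finrank ℝ A := hA.pos
  have : Module.Finite ℝ A := Module.finite_of_finrank_pos hpos
  have : Nontrivial A := Module.nontrivial_of_finrank_pos hpos
  by_cases hfield : IsField A
  · let := hfield.toField
    rcases Real.nonempty_algEquiv_or A with h | h
    · exact h.map AlgEquiv.toAlgHom
    · obtain ⟨e⟩ := h
      rw [e.toLinearEquiv.finrank_eq, Complex.finrank_real_complex] at hA
      exact absurd hA (by decide)
  · obtain ⟨x, hx0, hx⟩ := Ring.exists_not_isUnit_of_not_isField hfield
    set μ : A →ₗ[A] A := LinearMap.toSpanSingleton A A x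
    have hrank (I : Ideal A) : Module.finrank ℝ (A ⧸ I) +
        Module.finrank ℝ (I.restrictScalars ℝ) = Module.finrank ℝ A := by
      rw [← LinearMap.finrank_range_add_finrank_ker (Ideal.Quotient.mkₐ ℝ I).toLinearMap,
        LinearMap.range_eq_top.2 (Ideal.Quotient.mkₐ_surjective ℝ I), finrank_top]
      have : I.restrictScalars ℝ = LinearMap.ker (Ideal.Quotient.mkₐ ℝ I).toLinearMap := by
        ext y
        simp [Ideal.Quotient.eq_zero_iff_mem]
      rw [this]
    have h1 := hrank (LinearMap.range μ)
    have h2 := hrank (LinearMap.ker μ)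
    have h3 := LinearMap.finrank_range_add_finrank_ker (μ.restrictScalars ℝ)
    rw [LinearMap.range_restrictScalars, LinearMap.ker_restrictScalars] at h3
    have hsurj : ¬ Function.Surjective (μ.restrictScalars ℝ) := fun h => by
      obtain ⟨y, hy⟩ := h 1
      exact hx (IsUnit.of_mul_eq_one_right y (by simpa [μ] using hy))
    have hker : LinearMap.ker (μ.restrictScalars ℝ) ≠ ⊥ := fun h =>
      hsurj (LinearMap.injective_iff_surjective.1 (LinearMap.ker_eq_bot.1 h))
    have h4 : 0 < Module.finrank ℝ ((LinearMap.ker μ).restrictScalars ℝ) := by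
      rw [← LinearMap.ker_restrictScalars]
      exact Nat.pos_of_ne_zero fun h => hker (Submodule.finrank_eq_zero.1 h)
    have h5 : 0 < Module.finrank ℝ ((LinearMap.range μ).restrictScalars ℝ) := by
      rw [← LinearMap.range_restrictScalars]
      refine Nat.pos_of_ne_zero fun h => hx0 ?_
      have h6 := Submodule.finrank_eq_zero.1 h
      have : x ∈ LinearMap.range (μ.restrictScalars ℝ) := ⟨1, by simp [μ]⟩
      rw [h6] at this
      simpa using this
    have h7 : Odd (Module.finrank ℝ (A ⧸ LinearMap.range μ) +
        Module.finrank ℝ (A ⧸ LinearMap.ker μ)) := by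
      convert hA using 1
      omega
    rcases Nat.even_or_odd (Module.finrank ℝ (A ⧸ LinearMap.range μ)) with he | ho
    · have ho : Odd (Module.finrank ℝ (A ⧸ LinearMap.ker μ)) := by
        by_contra hne
        exact Nat.not_odd_iff_even.2 (he.add (Nat.not_odd_iff_even.1 hne)) h7
      obtain ⟨φ⟩ := ih _ (by omega) (A ⧸ LinearMap.ker μ) ho rfl
      exact ⟨φ.comp (Ideal.Quotient.mkₐ ℝ _)⟩
    · obtain ⟨φ⟩ := ih _ (by omega) (A ⧸ LinearMap.range μ) ho rfl
      exact ⟨φ.comp (Ideal.Quotient.mkₐ ℝ _)⟩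


/-- The product `∏ i, G i ^ (e i / D) * X i ^ (e i % D)`, obtained from the monomial `X ^ e` by
replacing as many factors `X i ^ D` as possible by `G i`. -/
noncomputable def powSubst {σ R : Type*} [Fintype σ] [CommRing R] (D : ℕ)
    (G : σ → MvPolynomial σ R) (e : σ →₀ ℕ) : MvPolynomial σ R :=
  ∏ i, (G i ^ (e i / D) * X i ^ (e i % D))

section powSubst

variable {σ R : Type*} [Fintype σ] [CommRing R] {D : ℕ}

theorem powSubst_map {S : Type*} [CommRing S] (φ : R →+* S) (G : σ → MvPolynomial σ R)
    (e : σ →₀ ℕ) :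
    map φ (powSubst D G e) = powSubst D (fun i => map φ (G i)) e := by
  simp [powSubst, map_prod]

theorem powSubst_X_pow (e : σ →₀ ℕ) :
    powSubst D (fun i => (X i ^ D : MvPolynomial σ R)) e = monomial e 1 := by
  rw [monomial_eq, Finsupp.prod_fintype _ _ (by simp), C_1, one_mul]
  refine Finset.prod_congr rfl fun i _ => ?_
  rw [← pow_mul, ← pow_add, Nat.div_add_mod]

theorem totalDegree_powSubst_le (G : σ → MvPolynomial σ R)
    (hG : ∀ i, (G i).totalDegree ≤ D) (e : σ →₀ ℕ) :
    (powSubst D G e).totalDegree ≤ e.degree := by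
  cases subsingleton_or_nontrivial R
  · simp [Subsingleton.elim (powSubst D G e) 0]
  rw [Finsupp.degree_eq_sum]
  refine (totalDegree_finsetProd _ _).trans (Finset.sum_le_sum fun i _ => ?_)
  calc (G i ^ (e i / D) * X i ^ (e i % D)).totalDegree
      ≤ (G i ^ (e i / D)).totalDegree + (X i ^ (e i % D) : MvPolynomial σ R).totalDegree :=
        totalDegree_mul _ _
    _ ≤ e i / D * D + e i % D := by
        gcongr
        · exact (totalDegree_pow _ _).trans (Nat.mul_le_mul_left _ (hG i))
        · simp
    _ = e i := Nat.div_add_mod' _ _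

theorem powSubst_mul [DecidableEq σ] (hD : 0 < D) (G : σ → MvPolynomial σ R) (e : σ →₀ ℕ)
    (i : σ) :
    powSubst D G e * G i = powSubst D G (e + Finsupp.single i D) := by
  unfold powSubst
  rw [← Finset.mul_prod_erase _ _ (Finset.mem_univ i),
    ← Finset.mul_prod_erase _ _ (Finset.mem_univ i)]
  have : ∀ j ∈ Finset.univ.erase i, G j ^ ((e + Finsupp.single i D) j / D) *
      X j ^ ((e + Finsupp.single i D) j % D) = G j ^ (e j / D) * X j ^ (e j % D) := by
    intro j hj
    rw [Finsupp.add_apply, Finsupp.single_eq_of_ne (Finset.ne_of_mem_erase hj), add_zero]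
  rw [Finset.prod_congr rfl this, Finsupp.add_apply, Finsupp.single_eq_same,
    Nat.add_div_right _ hD, Nat.add_mod_right, pow_succ]
  ring

theorem powSubst_mem_span (hD : 0 < D) (G : σ → MvPolynomial σ R) (e : σ →₀ ℕ) {i : σ}
    (hi : D ≤ e i) :
    powSubst D G e ∈ Ideal.span (Set.range G) := by
  refine Ideal.mem_of_dvd _ ?_ (Ideal.subset_span ⟨i, rfl⟩)
  refine dvd_trans ?_ (Finset.dvd_prod_of_mem _ (Finset.mem_univ i))
  exact dvd_mul_of_dvd_left (dvd_pow_self _ (Nat.div_pos hi hD).ne') _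

end powSubst


theorem exists_finite_powSubst_det_ne_zero {σ : Type*} [Fintype σ] (D : ℕ)
    (h : σ → MvPolynomial σ ℝ) {E : Type*} [Fintype E] [DecidableEq E] {ι : E → σ →₀ ℕ}
    (hι : Function.Injective ι) :
    ∃ S : Set ℝ, S.Finite ∧ ∀ s ∉ S, (Matrix.of fun e' e : E =>
        coeff (ι e') (powSubst D (fun i => X i ^ D + C s * h i) (ι e))).det ≠ 0 := by
  let G (i : σ) : MvPolynomial σ (Polynomial ℝ) :=
    X i ^ D + C Polynomial.X * map Polynomial.C (h i)
  let M : Matrix E E (Polynomial ℝ) := Matrix.of fun e' e => coeff (ι e') (powSubst D G (ι e))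
  have hM (s : ℝ) : M.det.eval s = (Matrix.of fun e' e : E =>
      coeff (ι e') (powSubst D (fun i => X i ^ D + C s * h i) (ι e))).det := by
    rw [← Polynomial.coe_evalRingHom, RingHom.map_det]
    congr 1
    ext e' e
    have hs : (Polynomial.evalRingHom s).comp Polynomial.C = RingHom.id ℝ := by
      ext
      simp
    simp only [M, G, RingHom.mapMatrix_apply, Matrix.map_apply, Matrix.of_apply, ← coeff_map,
      powSubst_map, map_add, map_mul, map_pow, map_X, map_C, map_map, hs, map_id]
    simp
  have h0 : M.det ≠ 0 := fun h0 => by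
    have h1 := hM 0
    have h2 : (Matrix.of fun e' e : E =>
        coeff (ι e') (powSubst D (fun i => X i ^ D + C (0 : ℝ) * h i) (ι e))) = 1 := by
      ext e' e
      simp only [C_0, zero_mul, add_zero, powSubst_X_pow, Matrix.of_apply, Matrix.one_apply]
      classical
      rw [coeff_monomial]
      simp only [hι.eq_iff, eq_comm]
    rw [h0, h2] at h1
    simp at h1
  refine ⟨{s | M.det.IsRoot s}, Polynomial.finite_setOfPred_isRoot h0, fun s hs => ?_⟩
  rw [← hM]
  exact hs

theorem exists_countable_powSubst_basis {σ : Type*} [Fintype σ] (D : ℕ)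
    (h : σ → MvPolynomial σ ℝ) (hh : ∀ i, (h i).totalDegree ≤ D) :
    ∃ S : Set ℝ, S.Countable ∧ ∀ s ∉ S, ∃ b : Module.Basis (σ →₀ ℕ) ℝ (MvPolynomial σ ℝ),
      ∀ e, b e = powSubst D (fun i => X i ^ D + C s * h i) e := by
  classical
  have (m : ℕ) : Fintype {e : σ →₀ ℕ // e.degree ≤ m} := (Finsupp.finite_of_degree_le m).fintype
  choose S hS hdet using fun m : ℕ => exists_finite_powSubst_det_ne_zero D h
    (Subtype.val_injective (p := fun e : σ →₀ ℕ => e.degree ≤ m))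
  refine ⟨⋃ m, S m, Set.countable_iUnion fun m => (hS m).countable, fun s hs => ?_⟩
  replace hdet (m : ℕ) := hdet m s fun hm => hs (Set.mem_iUnion_of_mem m hm)
  set b := powSubst D (fun i => X i ^ D + C s * h i) with hb
  have hdeg (e : σ →₀ ℕ) : (b e).totalDegree ≤ e.degree := by
    refine totalDegree_powSubst_le _ (fun i => (totalDegree_add _ _).trans (max_le ?_ ?_)) e
    · simp
    · exact (totalDegree_mul _ _).trans (by simpa using hh i)
  have hli : LinearIndependent ℝ b := by
    rw [linearIndependent_iff']
    intro t c hc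
    obtain ⟨m, hm⟩ : ∃ m, ∀ e ∈ t, e.degree ≤ m :=
      ⟨t.sup Finsupp.degree, fun e he => Finset.le_sup (f := Finsupp.degree) he⟩
    have key := Matrix.eq_zero_of_mulVec_eq_zero (hdet m)
      (v := fun e => if e.1 ∈ t then c e.1 else 0) (by
        ext e'
        have := congrArg (coeff e'.1) hc
        rw [coeff_sum] at this
        simp only [Matrix.mulVec, dotProduct, Matrix.of_apply, mul_ite, mul_zero, Pi.zero_apply]
        rw [← Finset.sum_filter, ← coeff_zero e'.1, ← this]
        refine Finset.sum_bij (fun e _ => e.1) (by simp) (fun _ _ _ _ => Subtype.ext)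
          (fun e he => ⟨⟨e, hm e he⟩, by simpa using he, rfl⟩) fun e he => ?_
        simp [mul_comm])
    intro e he
    simpa [he] using congrFun key ⟨e, hm e he⟩
  have hspan : ⊤ ≤ Submodule.span ℝ (Set.range b) := by
    rw [← (basisMonomials σ ℝ).span_eq, Submodule.span_le]
    rintro _ ⟨e₀, rfl⟩
    set M := Matrix.of fun e' e : {e : σ →₀ ℕ // e.degree ≤ e₀.degree} => coeff e'.1 (b e.1)
      with hM
    have hu : IsUnit M.det := (hdet e₀.degree).isUnit
    let v : {e : σ →₀ ℕ // e.degree ≤ e₀.degree} → ℝ := Pi.single ⟨e₀, le_rfl⟩ 1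
    have hv : M.mulVec (M⁻¹.mulVec v) = v := by
      rw [Matrix.mulVec_mulVec, Matrix.mul_nonsing_inv _ hu, Matrix.one_mulVec]
    have : basisMonomials σ ℝ e₀ = ∑ e, (M⁻¹.mulVec v) e • b e.1 := by
      ext e'
      rw [coeff_sum]
      by_cases he' : e'.degree ≤ e₀.degree
      · have h1 := congrFun hv ⟨e', he'⟩
        simp only [Matrix.mulVec, dotProduct, hM, Matrix.of_apply, v] at h1
        simp only [coe_basisMonomials, coeff_monomial, coeff_smul, smul_eq_mul]
        rw [Finset.sum_congr rfl fun e _ => mul_comm _ _]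
        simp only [Matrix.mulVec, dotProduct, hM, v]
        rw [h1]
        simp [Pi.single_apply, Subtype.ext_iff, eq_comm]
      · rw [Finset.sum_eq_zero, coe_basisMonomials, coeff_monomial, if_neg]
        · rintro rfl
          exact he' le_rfl
        · intro e _
          rw [coeff_smul, coeff_eq_zero_of_totalDegree_lt, smul_zero]
          have := (hdeg e.1).trans e.2
          rw [← Finsupp.degree_apply]
          omega
    rw [SetLike.mem_coe, this]
    exact Submodule.sum_mem _ fun e _ => Submodule.smul_mem _ _ (Submodule.subset_span ⟨_, rfl⟩)
  exact ⟨Module.Basis.mk hli hspan, fun e => by simp⟩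

theorem finrank_quotient_span_of_powSubst_basis {σ : Type*} [Fintype σ] {D : ℕ} (hD : 0 < D)
    (G : σ → MvPolynomial σ ℝ) (b : Module.Basis (σ →₀ ℕ) ℝ (MvPolynomial σ ℝ))
    (hb : ∀ e, b e = powSubst D G e) :
    Module.finrank ℝ (MvPolynomial σ ℝ ⧸ Ideal.span (Set.range G)) = D ^ Fintype.card σ := by
  classical
  let box (a : σ → Fin D) : σ →₀ ℕ := Finsupp.equivFunOnFinite.symm fun i => (a i : ℕ)
  have hbox : Function.Injective box := fun a a' h => by
    ext i
    simpa [box] using DFunLike.congr_fun h i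
  let π : MvPolynomial σ ℝ →ₗ[ℝ] (σ → Fin D) → ℝ :=
    LinearMap.pi fun a => b.coord (box a)
  have hπ : Function.Surjective π := fun v => by
    refine ⟨∑ a, v a • b (box a), ?_⟩
    ext a
    simp [π, Finsupp.single_apply, hbox.eq_iff]
  have hπb {e : σ →₀ ℕ} {i : σ} (hi : D ≤ e i) : π (b e) = 0 := by
    ext a
    have : e ≠ box a := by
      rintro rfl
      exact absurd hi (by simp [box])
    simp [π, this]
  have hker : LinearMap.ker (Ideal.Quotient.mkₐ ℝ (Ideal.span (Set.range G))).toLinearMap =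
      LinearMap.ker π := by
    ext p
    simp only [LinearMap.mem_ker, AlgHom.toLinearMap_apply, Ideal.Quotient.mkₐ_eq_mk,
      Ideal.Quotient.eq_zero_iff_mem]
    constructor
    · intro hp
      obtain ⟨c, rfl⟩ := Ideal.mem_span_range_iff_exists_fun.1 hp
      rw [map_sum]
      refine Finset.sum_eq_zero fun i _ => ?_
      have hc : c i ∈ Submodule.span ℝ (Set.range b) := b.mem_span _
      generalize c i = q at hc
      induction hc using Submodule.span_induction with
      | zero => simp
      | add x y _ _ hx hy => rw [add_mul, map_add, hx, hy, add_zero]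
      | smul t x _ hx => rw [smul_mul_assoc, map_smul, hx, smul_zero]
      | mem x hx =>
        obtain ⟨e, rfl⟩ := hx
        rw [hb, powSubst_mul hD, ← hb]
        exact hπb (i := i) (by simp)
    · intro hp
      rw [← b.linearCombination_repr p, Finsupp.linearCombination_apply, Finsupp.sum]
      refine Ideal.sum_mem _ fun e he => ?_
      rw [smul_eq_C_mul]
      refine Ideal.mul_mem_left _ _ ?_
      by_contra hmem
      have hlt : ∀ i, e i < D := fun i => by
        by_contra! hi
        exact hmem (hb e ▸ powSubst_mem_span hD G e hi)
      have h1 := congrFun hp fun i => ⟨e i, hlt i⟩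
      have h2 : box (fun i => ⟨e i, hlt i⟩) = e := by
        ext i
        simp [box]
      simp only [π, LinearMap.pi_apply, Module.Basis.coord_apply, h2, Pi.zero_apply] at h1
      exact Finsupp.mem_support_iff.1 he h1
  have hmk : Function.Surjective
      (Ideal.Quotient.mkₐ ℝ (Ideal.span (Set.range G))).toLinearMap :=
    Ideal.Quotient.mkₐ_surjective ℝ _
  rw [((LinearMap.quotKerEquivOfSurjective _ hmk).symm ≪≫ₗ
    Submodule.quotEquivOfEq _ _ hker ≪≫ₗ LinearMap.quotKerEquivOfSurjective _ hπ).finrank_eq]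
  simp

/-- A generic system of `n` polynomial equations of odd degree `D` in `n` real unknowns has a
real solution. -/
theorem exists_countable_forall_exists_eval_eq_zero {σ : Type*} [Fintype σ] {D : ℕ} (hD : Odd D)
    (h : σ → MvPolynomial σ ℝ) (hh : ∀ i, (h i).totalDegree ≤ D) :
    ∃ S : Set ℝ, S.Countable ∧ ∀ s ∉ S, ∃ z : σ → ℝ, ∀ i, z i ^ D + s * eval z (h i) = 0 := by
  obtain ⟨S, hS, hb⟩ := exists_countable_powSubst_basis D h hh
  refine ⟨S, hS, fun s hs => ?_⟩
  obtain ⟨b, hb⟩ := hb s hs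
  obtain ⟨φ⟩ := exists_algHom_real_of_odd_finrank _
    ((finrank_quotient_span_of_powSubst_basis hD.pos _ b hb).symm ▸ hD.pow)
  let ψ := φ.comp (Ideal.Quotient.mkₐ ℝ _)
  have hψ (p : MvPolynomial σ ℝ) : ψ p = eval (fun i => ψ (X i)) p := by
    rw [← coe_aeval_eq_eval]
    exact DFunLike.congr_fun (aeval_unique ψ) p
  refine ⟨fun i => ψ (X i), fun i => ?_⟩
  have h1 : ψ (X i ^ D + C s * h i) = 0 := by
    simp only [ψ, AlgHom.comp_apply, Ideal.Quotient.mkₐ_eq_mk]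
    have hmem : X i ^ D + C s * h i ∈ Ideal.span (Set.range fun i => X i ^ D + C s * h i) :=
      Ideal.subset_span ⟨i, rfl⟩
    rw [Ideal.Quotient.eq_zero_iff_mem.2 hmem, map_zero]
  rw [hψ] at h1
  simpa using h1

theorem MvPolynomial.IsHomogeneous.eval_smul {σ R : Type*} [Fintype σ] [CommSemiring R]
    {p : MvPolynomial σ R} {n : ℕ} (hp : p.IsHomogeneous n) (r : R) (x : σ → R) :
    eval (r • x) p = r ^ n * eval x p := by
  rw [eval_eq', eval_eq', Finset.mul_sum]
  refine Finset.sum_congr rfl fun d hd => ?_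
  have h1 : d.degree = n := by
    by_contra hne
    exact mem_support_iff.1 hd (hp.coeff_eq_zero hne)
  simp only [Pi.smul_apply, smul_eq_mul, mul_pow, Finset.prod_mul_distrib,
    Finset.prod_pow_eq_pow_sum, ← Finsupp.degree_eq_sum, h1]
  ring

theorem MvPolynomial.totalDegree_aeval_le_of_totalDegree_le_one {σ τ R : Type*} [CommSemiring R]
    (p : MvPolynomial σ R) {g : σ → MvPolynomial τ R} (hg : ∀ i, (g i).totalDegree ≤ 1) :
    (aeval g p).totalDegree ≤ p.totalDegree := by
  rw [aeval_def, eval₂_eq]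
  refine totalDegree_finsetSum_le fun d hd => ?_
  refine (totalDegree_mul _ _).trans ?_
  rw [algebraMap_eq, totalDegree_C, zero_add]
  refine (totalDegree_finsetProd _ _).trans (le_trans ?_ (le_totalDegree hd))
  refine Finset.sum_le_sum fun i _ => (totalDegree_pow _ _).trans ?_
  simpa using Nat.mul_le_mul_left (d i) (hg i)

/-- Every polynomial has a form of a given large odd degree which agrees with its odd part on the
unit sphere. -/
theorem exists_isHomogeneous_eval_eq_odd_part {ι : Type*} [Fintype ι] (p : MvPolynomial ι ℝ)
    {D : ℕ} (hD : Odd D) (hp : p.totalDegree ≤ D) :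
    ∃ f : MvPolynomial ι ℝ, f.IsHomogeneous D ∧
      ∀ x : ι → ℝ, ∑ i, x i ^ 2 = 1 → eval x f = (eval x p - eval (-x) p) / 2 := by
  set N : MvPolynomial ι ℝ := ∑ i, X i ^ 2 with hN
  have hNh : N.IsHomogeneous 2 := IsHomogeneous.sum _ _ _ fun i _ => isHomogeneous_X_pow i 2
  refine ⟨∑ k ∈ (Finset.range (p.totalDegree + 1)).filter Odd,
    homogeneousComponent k p * N ^ ((D - k) / 2), ?_, fun x hx => ?_⟩
  · refine IsHomogeneous.sum _ _ _ fun k hk => ?_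
    rw [Finset.mem_filter, Finset.mem_range] at hk
    have h1 := (homogeneousComponent_isHomogeneous k p).mul (hNh.pow ((D - k) / 2))
    have h2 : k + 2 * ((D - k) / 2) = D := by
      obtain ⟨⟨a, rfl⟩, b, rfl⟩ := And.intro hD hk.2
      omega
    rwa [h2] at h1
  · have hNx : eval x N = 1 := by simpa [hN] using hx
    have h1 (y : ι → ℝ) : eval y p = ∑ k ∈ Finset.range (p.totalDegree + 1),
        eval y (homogeneousComponent k p) := by
      rw [← map_sum, sum_homogeneousComponent]
    rw [h1, h1, ← Finset.sum_sub_distrib, Finset.sum_div, map_sum, Finset.sum_filter]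
    refine Finset.sum_congr rfl fun k _ => ?_
    rw [← neg_one_smul ℝ x, (homogeneousComponent_isHomogeneous k p).eval_smul]
    split_ifs with hk
    · simp [hNx, hk.neg_one_pow]
    · simp [(Nat.not_odd_iff_even.1 hk).neg_one_pow]

theorem exists_eval_near_of_isCompact {ι : Type*} {S : Set (ι → ℝ)} (hS : IsCompact S)
    {g : (ι → ℝ) → ℝ} (hg : ContinuousOn g S) {ε : ℝ} (hε : 0 < ε) :
    ∃ p : MvPolynomial ι ℝ, ∀ x ∈ S, |eval x p - g x| < ε := by
  have : CompactSpace S := isCompact_iff_compactSpace.1 hS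
  let coord (i : ι) : C(S, ℝ) := ⟨fun x => x.1 i, (continuous_apply i).comp continuous_subtype_val⟩
  have hsep : (aeval (R := ℝ) coord).range.SeparatesPoints := fun x y hxy => by
    obtain ⟨i, hi⟩ := Function.ne_iff.1 (Subtype.coe_injective.ne hxy)
    exact ⟨_, ⟨coord i, ⟨X i, by simp⟩, rfl⟩, hi⟩
  obtain ⟨⟨_, p, rfl⟩, hp⟩ :=
    ContinuousMap.exists_mem_subalgebra_near_continuousMap_of_separatesPoints
      (aeval coord).range hsep ⟨S.domRestrict g, hg.domRestrict⟩ ε hε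
  refine ⟨p, fun x hx => ?_⟩
  have h1 := (ContinuousMap.norm_coe_le_norm _ ⟨x, hx⟩).trans_lt hp
  have h2 : (aeval coord p) ⟨x, hx⟩ = eval x p := by
    have := comp_aeval_apply coord (ContinuousMap.evalAlgHom ℝ ℝ (⟨x, hx⟩ : S)) p
    rw [← coe_aeval_eq_eval]
    exact this
  rw [← h2]
  exact h1

theorem isCompact_sum_sq_eq_one (ι : Type*) [Fintype ι] :
    IsCompact {x : ι → ℝ | ∑ i, x i ^ 2 = 1} := by
  refine (isCompact_closedBall (0 : ι → ℝ) 1).of_isClosed_subset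
    (isClosed_eq (by fun_prop) continuous_const) fun x hx => ?_
  rw [mem_closedBall_zero_iff, pi_norm_le_iff_of_nonneg zero_le_one]
  intro i
  rw [Real.norm_eq_abs, ← sq_le_one_iff_abs_le_one]
  exact hx ▸ Finset.single_le_sum (f := fun i => x i ^ 2) (fun j _ => sq_nonneg (x j))
    (Finset.mem_univ i)

theorem borsuk_ulam_option {κ : Type*} [Fintype κ] {g : (Option κ → ℝ) → κ → ℝ}
    (hg : ContinuousOn g {x | ∑ i, x i ^ 2 = 1}) (hodd : ∀ x, g (-x) = -g x) :
    ∃ x : Option κ → ℝ, ∑ i, x i ^ 2 = 1 ∧ g x = 0 := by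
  classical
  set S : Set (Option κ → ℝ) := {x | ∑ i, x i ^ 2 = 1} with hS
  by_contra! hne
  obtain ⟨x₀, hx₀, hmin⟩ := (isCompact_sum_sq_eq_one (Option κ)).exists_isMinOn
    ⟨Pi.single none 1, by simp⟩ hg.norm
  set δ := ‖g x₀‖
  have hδ : 0 < δ := norm_pos_iff.2 (hne x₀ hx₀)
  choose p hp using fun k : κ => exists_eval_near_of_isCompact (isCompact_sum_sq_eq_one (Option κ))
    (continuousOn_pi.1 hg k) (half_pos hδ)
  set D := 2 * (Finset.univ.sup fun k => (p k).totalDegree) + 1 with hD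
  have hDodd : Odd D := ⟨_, rfl⟩
  have hpD (k : κ) : (p k).totalDegree ≤ D := by
    have := Finset.le_sup (f := fun k => (p k).totalDegree) (Finset.mem_univ k)
    omega
  choose f hfh hf using fun k => exists_isHomogeneous_eval_eq_odd_part (p k) hDodd (hpD k)
  have hfg (k : κ) (x) (hx : x ∈ S) : |eval x (f k) - g x k| < δ / 2 := by
    have hx' : -x ∈ S := by simpa [hS] using hx
    have h1 := abs_lt.1 (hp k x hx)
    have h2 := abs_lt.1 (hp k (-x) hx')
    rw [hodd, Pi.neg_apply] at h2
    rw [hf k x hx, abs_lt]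
    constructor <;> linarith
  obtain ⟨T, hT, hz⟩ := exists_countable_forall_exists_eval_eq_zero hDodd
    (fun k => aeval (fun o : Option κ => o.elim 1 X) (f k)) fun k =>
      (totalDegree_aeval_le_of_totalDegree_le_one _ fun o => by
        cases o <;> simp).trans (hfh k).totalDegree_le
  obtain ⟨s, hsT, hs⟩ := (hT.dense_compl ℝ).exists_gt (2 / δ)
  obtain ⟨z, hz⟩ := hz s hsT
  have hs0 : 0 < s := lt_trans (by positivity) hs
  set w : Option κ → ℝ := fun o => o.elim 1 z with hw
  have hwz (k : κ) : eval z (aeval (fun o : Option κ => o.elim 1 X) (f k)) = eval w (f k) := by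
    rw [← coe_aeval_eq_eval, ← coe_aeval_eq_eval, RingHom.coe_coe, RingHom.coe_coe,
      comp_aeval_apply]
    congr 2
    ext o
    cases o <;> simp [hw]
  set r := √(∑ i, w i ^ 2) with hr
  have hr1 : 0 < ∑ i, w i ^ 2 := by
    rw [Fintype.sum_option]
    have : 0 ≤ ∑ k, w (some k) ^ 2 := Finset.sum_nonneg fun _ _ => sq_nonneg _
    simp only [hw, Option.elim] at this ⊢
    linarith
  have hu : r⁻¹ • w ∈ S := by
    simp only [hS, Set.mem_ofPred_eq, Pi.smul_apply, smul_eq_mul, mul_pow]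
    rw [← Finset.mul_sum, inv_pow, hr, Real.sq_sqrt hr1.le, inv_mul_cancel₀ hr1.ne']
  set u := r⁻¹ • w with hu'
  have hsmall (k : κ) : |eval u (f k)| < δ / 2 := by
    have h1 : u (some k) ^ D + s * eval u (f k) = 0 := by
      rw [hu', (hfh k).eval_smul, ← hwz, Pi.smul_apply, smul_eq_mul, mul_pow,
        show w (some k) = z k from rfl]
      linear_combination (r⁻¹ ^ D) * hz k
    have h2 : |u (some k)| ≤ 1 := by
      rw [← sq_le_one_iff_abs_le_one]
      exact hu ▸ Finset.single_le_sum (f := fun i => u i ^ 2) (fun j _ => sq_nonneg (u j))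
        (Finset.mem_univ (some k))
    have h3 : s * |eval u (f k)| ≤ 1 := by
      rw [← abs_of_pos hs0, ← abs_mul, ← neg_eq_of_add_eq_zero_right h1, abs_neg, abs_pow]
      exact pow_le_one₀ (abs_nonneg _) h2
    rw [div_lt_iff₀ hδ] at hs
    nlinarith
  have : ‖g u‖ < δ := by
    rw [pi_norm_lt_iff hδ]
    intro k
    have h1 := abs_lt.1 (hfg k u hu)
    have h2 := abs_lt.1 (hsmall k)
    rw [Real.norm_eq_abs, abs_lt]
    constructor <;> linarith
  exact absurd (hmin hu) (not_le.2 this)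

/-- The **Borsuk–Ulam theorem**: an odd continuous map from the unit sphere of a Euclidean space
to a space of dimension one less than that of the Euclidean space has a zero. -/
theorem borsuk_ulam {ι κ : Type*} [Fintype ι] [Fintype κ]
    (hcard : Fintype.card ι = Fintype.card κ + 1) {g : (ι → ℝ) → κ → ℝ}
    (hg : ContinuousOn g {x | ∑ i, x i ^ 2 = 1}) (hodd : ∀ x, g (-x) = -g x) :
    ∃ x : ι → ℝ, ∑ i, x i ^ 2 = 1 ∧ g x = 0 := by
  let e : ι ≃ Option κ := Fintype.equivOfCardEq (by simpa using hcard)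
  have hsum (x : Option κ → ℝ) : ∑ i, (x ∘ e) i ^ 2 = ∑ i, x i ^ 2 :=
    e.sum_comp fun i => x i ^ 2
  obtain ⟨x, hx, hgx⟩ := borsuk_ulam_option (g := fun x => g (x ∘ e))
    (hg.comp (by fun_prop) fun x hx => (hsum x).trans hx) fun x => hodd (x ∘ e)
  exact ⟨x ∘ e, (hsum x).trans hx, hgx⟩

end BorsukUlam

/-- The triple `(p, q, 0)` translated so that its median becomes zero. Its positive part and its
negative part have at most one nonzero entry each, so that this is an odd parametrization of the
open cone over the deleted join of three points by the plane. -/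
noncomputable def medianCentered (p q : ℝ) (j : Fin 3) : ℝ :=
  ![p, q, 0] j - max (min p q) (min (max p q) 0)

theorem medianCentered_neg (p q : ℝ) (j : Fin 3) :
    medianCentered (-p) (-q) j = -medianCentered p q j := by
  fin_cases j <;> simp only [medianCentered] <;> simp <;> grind

theorem medianCentered_eq_zero {p q : ℝ} (h : ∀ j, medianCentered p q j = 0) : p = 0 ∧ q = 0 := by
  have h0 := h 0
  have h1 := h 1
  have h2 := h 2
  simp [medianCentered] at h0 h1 h2
  grind

theorem exists_forall_ne_medianCentered_le (p q : ℝ) :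
    ∃ j, ∀ k ≠ j, medianCentered p q k ≤ 0 := by
  have h0 : medianCentered p q 0 = p - max (min p q) (min (max p q) 0) := rfl
  have h1 : medianCentered p q 1 = q - max (min p q) (min (max p q) 0) := rfl
  have h2 : medianCentered p q 2 = 0 - max (min p q) (min (max p q) 0) := rfl
  by_cases h : p ≤ q
  · by_cases h' : q ≤ 0
    · exact ⟨2, fun k hk => by fin_cases k <;> simp at hk ⊢ <;> grind⟩
    · exact ⟨1, fun k hk => by fin_cases k <;> simp at hk ⊢ <;> grind⟩
  · by_cases h' : p ≤ 0
    · exact ⟨2, fun k hk => by fin_cases k <;> simp at hk ⊢ <;> grind⟩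
    · exact ⟨0, fun k hk => by fin_cases k <;> simp at hk ⊢ <;> grind⟩

theorem continuous_medianCentered {X : Type*} [TopologicalSpace X] {p q : X → ℝ}
    (hp : Continuous p) (hq : Continuous q) (j : Fin 3) :
    Continuous fun x => medianCentered (p x) (q x) j := by
  unfold medianCentered
  fin_cases j <;> simp <;> fun_prop

theorem isCompact_polyhedron (n : ℕ) (K : Finset (Finset (Fin n))) :
    IsCompact (polyhedron n K) :=
  K.isCompact_biUnion fun F _ => ((F.finite_toSet.image _).isCompact_convexHull ℝ)

theorem sum_smul_single_mem_polyhedron {n : ℕ} {K : Finset (Finset (Fin n))} {ι : Type*}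
    [Fintype ι] (v : ι → Fin n) (hv : Finset.univ.image v ∈ K) {t : ι → ℝ} (ht : ∀ i, 0 ≤ t i)
    (hsum : ∑ i, t i = 1) : ∑ i, t i • (Pi.single (v i) 1 : Fin n → ℝ) ∈ polyhedron n K := by
  refine Set.mem_biUnion hv ((convex_convexHull ℝ _).sum_mem (fun i _ => ht i) hsum fun i _ => ?_)
  exact subset_convexHull ℝ _ ⟨v i, by simp, rfl⟩

theorem continuous_smul_comp_inv_smul {X E F : Type*} [TopologicalSpace X] [NormedAddCommGroup E]
    [NormedSpace ℝ E] [NormedAddCommGroup F] [NormedSpace ℝ F] {s : Set E} (hs : IsCompact s)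
    {f : E → F} (hf : Continuous f) {m : X → ℝ} (hm : Continuous m) {x : X → E}
    (hx : Continuous x) (hmem : ∀ u, m u ≠ 0 → (m u)⁻¹ • x u ∈ s) :
    Continuous fun u => m u • f ((m u)⁻¹ • x u) := by
  rw [continuous_iff_continuousAt]
  intro u
  by_cases hu : m u = 0
  · obtain ⟨C, hC⟩ := hs.exists_bound_of_continuousOn hf.continuousOn
    have h1 : Filter.Tendsto (fun v => |m v| * C) (nhds u) (nhds 0) := by
      have : Continuous fun v => |m v| * C := by fun_prop
      simpa [hu] using this.tendsto u
    rw [ContinuousAt, hu, zero_smul]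
    refine squeeze_zero_norm (fun v => ?_) h1
    rw [norm_smul, Real.norm_eq_abs]
    by_cases hv : m v = 0
    · simp [hv]
    · exact mul_le_mul_of_nonneg_left (hC _ (hmem v hv)) (abs_nonneg _)
  · exact hm.continuousAt.smul
      (hf.continuousAt.comp ((hm.continuousAt.inv₀ hu).smul hx.continuousAt))

/-- **Van Kampen–Flores**: a complex which contains the join of `d + 1` copies of three points does
not embed into `ℝ^{2d}`. -/
theorem not_injective_of_join_three_points {d n : ℕ} {K : Finset (Finset (Fin n))}
    (w : Fin (d + 1) × Fin 3 → Fin n) (hw : Function.Injective w)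
    (hface : ∀ c : Fin (d + 1) → Fin 3, (Finset.univ.image fun i => w (i, c i)) ∈ K)
    {f : polyhedron n K → (Fin (2 * d) → ℝ)} (hf : Continuous f) : ¬ Function.Injective f := by
  intro hinj
  obtain ⟨f', hf'⟩ := ContinuousMap.exists_restrict_eq (isCompact_polyhedron n K).isClosed ⟨f, hf⟩
  have hff' (x : polyhedron n K) : f' x = f x := DFunLike.congr_fun hf' x
  let b (u : Fin (d + 1) × Fin 2 → ℝ) (ij : Fin (d + 1) × Fin 3) : ℝ :=
    medianCentered (u (ij.1, 0)) (u (ij.1, 1)) ij.2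
  have hbneg (u) (ij) : b (-u) ij = -b u ij := medianCentered_neg _ _ _
  let t (u) (ij) : ℝ := max (b u ij) 0
  have htb (u) (ij) : t u ij - t (-u) ij = b u ij := by
    simp only [t, hbneg]
    grind
  have htmul (u) (ij) : t u ij = 0 ∨ t (-u) ij = 0 := by
    simp only [t, hbneg]
    grind
  have htcont (ij) : Continuous fun u => t u ij :=
    (continuous_medianCentered (by fun_prop) (by fun_prop) _).max continuous_const
  have ht0 (u) (ij) : 0 ≤ t u ij := le_max_right _ _
  let m (u) : ℝ := ∑ ij, t u ij
  let x (u) : Fin n → ℝ := ∑ ij, t u ij • Pi.single (w ij) 1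
  have hxw (u) (ij) : x u (w ij) = t u ij := by
    simp [x, Finset.sum_apply, Pi.single_apply, hw.eq_iff]
  have hmcont : Continuous m := continuous_finsetSum _ fun ij _ => htcont ij
  have hxcont : Continuous x :=
    continuous_finsetSum _ fun ij _ => (htcont ij).smul continuous_const
  have hmem (u) (hu : m u ≠ 0) : (m u)⁻¹ • x u ∈ polyhedron n K := by
    choose c hc using fun i : Fin (d + 1) =>
      exists_forall_ne_medianCentered_le (u (i, 0)) (u (i, 1))
    have hsum {E : Type} [AddCommMonoid E] (h : Fin (d + 1) × Fin 3 → E)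
        (hh : ∀ ij, t u ij = 0 → h ij = 0) : ∑ ij, h ij = ∑ i, h (i, c i) := by
      rw [Fintype.sum_prod_type]
      refine Finset.sum_congr rfl fun i _ => ?_
      exact Finset.sum_eq_single (c i) (fun j _ hj => hh _ (max_eq_right (hc i j hj))) (by simp)
    have hm1 : m u = ∑ i, t u (i, c i) := hsum _ fun _ => id
    have hx1 : x u = ∑ i, t u (i, c i) • Pi.single (w (i, c i)) 1 :=
      hsum _ fun ij h => by rw [h, zero_smul]
    rw [hx1, Finset.smul_sum]
    simp_rw [smul_smul]
    refine sum_smul_single_mem_polyhedron (fun i => w (i, c i)) (hface c) (fun i => ?_) ?_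
    · exact mul_nonneg (inv_nonneg.2 (Finset.sum_nonneg fun ij _ => ht0 u ij)) (ht0 _ _)
    · rw [← Finset.mul_sum, ← hm1, inv_mul_cancel₀ hu]
  let φ (u) : Fin (2 * d) → ℝ := m u • f' ((m u)⁻¹ • x u)
  have hφ : Continuous φ :=
    continuous_smul_comp_inv_smul (isCompact_polyhedron n K) f'.continuous hmcont hxcont hmem
  let g (u) : Fin (2 * d) ⊕ Unit → ℝ := Sum.elim (φ u - φ (-u)) fun _ => m u - m (-u)
  obtain ⟨u, hu, hgu⟩ := borsuk_ulam (g := g) (by simp; ring)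
    (Continuous.continuousOn (continuous_pi fun k => by
      cases k with
      | inl k => exact ((continuous_apply k).comp (hφ.sub (hφ.comp continuous_neg)))
      | inr k => exact hmcont.sub (hmcont.comp continuous_neg)))
    (fun u => by ext k; cases k <;> simp [g])
  have hmu : m u = m (-u) := sub_eq_zero.1 (congrFun hgu (Sum.inr ()))
  have hφu : φ u = φ (-u) := by
    ext k
    exact sub_eq_zero.1 (congrFun hgu (Sum.inl k))
  have hm0 : m u ≠ 0 := fun h0 => by
    have hz (v) (hv : m v = 0) (ij) : t v ij = 0 :=
      (Finset.sum_eq_zero_iff_of_nonneg fun ij _ => ht0 v ij).1 hv ij (Finset.mem_univ _)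
    have hb0 (ij) : b u ij = 0 := by
      rw [← htb, hz u h0, hz (-u) (hmu ▸ h0), sub_zero]
    have hu0 : u = 0 := by
      ext ⟨i, j⟩
      have := medianCentered_eq_zero (p := u (i, 0)) (q := u (i, 1)) fun j => hb0 (i, j)
      fin_cases j
      exacts [this.1, this.2]
    simp [hu0] at hu
  have heq : x u = x (-u) := by
    have h1 : f ⟨_, hmem u hm0⟩ = f ⟨_, hmem (-u) (hmu ▸ hm0)⟩ := by
      rw [← hff', ← hff']
      have h2 : m u • f' ((m u)⁻¹ • x u) = m (-u) • f' ((m (-u))⁻¹ • x (-u)) := hφu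
      simp only [← hmu] at h2 ⊢
      exact smul_right_injective _ hm0 h2
    have h3 := congrArg Subtype.val (hinj h1)
    simp only [← hmu] at h3
    exact smul_right_injective _ (inv_ne_zero hm0) h3
  refine hm0 (Finset.sum_eq_zero fun ij _ => ?_)
  have h4 := hxw u ij
  rw [heq, hxw] at h4
  rcases htmul u ij with h | h
  · exact h
  · rw [← h4, h]

theorem cube_div_two_sub_nine_le_six_mul_choose_three (t : ℕ) :
    (t : ℝ) ^ 3 / 2 - 9 ≤ 6 * (t.choose 3 : ℝ) := by
  have h : (6 : ℝ) * (t.choose 3 : ℝ) = t * (t - 1) * (t - 2) := by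
    rw [Nat.cast_choose_eq_descPochhammer_div]
    simp [descPochhammer_succ_right, Nat.factorial]
    ring
  rw [h]
  have ht : (0 : ℝ) ≤ t := t.cast_nonneg
  nlinarith [mul_nonneg ht (sq_nonneg ((t : ℝ) - 4)), sq_nonneg ((t : ℝ) - 4)]

theorem exists_three_lt_card_common {V Y : Type*} [Fintype V] [Fintype Y] [DecidableEq V]
    [DecidableEq Y] (H : Finset (V × Y)) {B : ℝ} (hB : 0 ≤ B)
    (h : (Fintype.card V : ℝ) ^ 3 * B <
      (H.card : ℝ) ^ 3 / (2 * (Fintype.card Y : ℝ) ^ 2) - 9 * Fintype.card Y) :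
    ∃ T : Finset V, T.card = 3 ∧ ∃ H' : Finset Y, B < H'.card ∧ ∀ y ∈ H', ∀ x ∈ T, (x, y) ∈ H := by
  by_contra! hall
  replace hall (T : Finset V) (hT : T.card = 3) :
      ((Finset.univ.filter fun y => ∀ x ∈ T, (x, y) ∈ H).card : ℝ) ≤ B := by
    by_contra! hlt
    obtain ⟨y, hy, x, hx, h⟩ := hall T hT _ hlt
    exact h ((Finset.mem_filter.1 hy).2 x hx)
  let N (y : Y) : Finset V := Finset.univ.filter fun x => (x, y) ∈ H
  have hH : H.card = ∑ y, (N y).card := by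
    simp only [N, Finset.card_filter]
    rw [Finset.sum_comm, ← Fintype.sum_prod_type fun p : V × Y => if p ∈ H then 1 else 0]
    simp
  have hcount : ∑ y, (N y).card.choose 3 = ∑ T ∈ Finset.powersetCard 3 (Finset.univ : Finset V),
      (Finset.univ.filter fun y => ∀ x ∈ T, (x, y) ∈ H).card := by
    simp_rw [← Finset.card_powersetCard 3 (N _), Finset.card_eq_sum_ones, Finset.sum_filter]
    rw [Finset.sum_comm]
    refine Finset.sum_congr rfl fun y _ => ?_
    rw [← Finset.sum_filter]
    congr 1
    ext T
    simp [Finset.mem_powersetCard, Finset.subset_iff, N, and_comm]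
  have hup : 6 * ∑ y, ((N y).card.choose 3 : ℝ) ≤ (Fintype.card V : ℝ) ^ 3 * B := by
    rw [← Nat.cast_sum, hcount, Nat.cast_sum]
    have h1 := Finset.sum_le_card_nsmul (Finset.powersetCard 3 (Finset.univ : Finset V))
      (fun T => ((Finset.univ.filter fun y => ∀ x ∈ T, (x, y) ∈ H).card : ℝ)) B
      fun T hT => hall T (Finset.mem_powersetCard.1 hT).2
    rw [Finset.card_powersetCard, Finset.card_univ, nsmul_eq_mul] at h1
    have h2 := Nat.choose_le_pow_div (α := ℝ) 3 (Fintype.card V)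
    rw [le_div_iff₀ (by positivity)] at h2
    norm_num [Nat.factorial] at h2
    nlinarith [mul_le_mul_of_nonneg_right h2 hB]
  have hlow : (H.card : ℝ) ^ 3 / (2 * (Fintype.card Y : ℝ) ^ 2) - 9 * Fintype.card Y ≤
      6 * ∑ y, ((N y).card.choose 3 : ℝ) := by
    have h1 := pow_sum_div_card_le_sum_pow (s := Finset.univ) (f := fun y => ((N y).card : ℝ))
      (fun y _ => Nat.cast_nonneg _) 2
    rw [← Nat.cast_sum, ← hH, Finset.card_univ] at h1
    have h2 := Finset.sum_le_sum fun y (_ : y ∈ Finset.univ) =>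
      cube_div_two_sub_nine_le_six_mul_choose_three (N y).card
    rw [← Finset.mul_sum, Finset.sum_sub_distrib, ← Finset.sum_div, Finset.sum_const,
      Finset.card_univ, nsmul_eq_mul] at h2
    rw [mul_comm 2, ← div_div]
    linarith
  linarith

theorem exists_slice_of_card_ge {n r : ℕ} (hn : 4 ≤ n) (H : Finset (Fin (r + 2) → Fin n))
    (hH : 2 * (n : ℝ) ^ ((r : ℝ) + 2 - 1 / 3 ^ (r + 1)) ≤ H.card) :
    ∃ T : Finset (Fin n), T.card = 3 ∧ ∃ H' : Finset (Fin (r + 1) → Fin n),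
      3 * (n : ℝ) ^ ((r : ℝ) + 1 - 1 / 3 ^ r) ≤ H'.card ∧
      ∀ y ∈ H', ∀ x ∈ T, (Fin.cons x y : Fin (r + 2) → Fin n) ∈ H := by
  have hn4 : (4 : ℝ) ≤ n := by exact_mod_cast hn
  have hn0 : (0 : ℝ) < n := by linarith
  set δ : ℝ := 1 / 3 ^ r with hδ
  have hδ1 : δ ≤ 1 := by
    rw [hδ, div_le_one (by positivity)]
    exact one_le_pow₀ (by norm_num)
  set P : ℝ := (n : ℝ) ^ ((r : ℝ) + 1 - δ)
  set M : ℝ := (n : ℝ) ^ (r + 1) with hM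
  have hM0 : 0 < M := by positivity
  have hP0 : 0 < P := by positivity
  have hcube : ((n : ℝ) ^ ((r : ℝ) + 2 - 1 / 3 ^ (r + 1))) ^ 3 = M ^ 2 * n ^ 3 * P := by
    have h1 : M ^ 2 * (n : ℝ) ^ 3 = (n : ℝ) ^ ((2 * r + 5 : ℕ) : ℝ) := by
      rw [hM, Real.rpow_natCast]
      ring
    rw [h1, ← Real.rpow_add hn0, ← Real.rpow_mul_natCast hn0.le]
    congr 1
    rw [hδ]
    push_cast
    field_simp
    ring
  have hPM : M ≤ n * P := by
    rw [hM, ← Real.rpow_natCast, ← Real.rpow_one_add' hn0.le (by linarith [r.cast_nonneg (α := ℝ)])]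
    refine Real.rpow_le_rpow_of_exponent_le (by linarith) ?_
    push_cast
    linarith
  let e := Fin.consEquiv fun _ : Fin (r + 2) => Fin n
  obtain ⟨T, hT, H', hlt, hmem⟩ := exists_three_lt_card_common (H.map e.symm.toEmbedding)
    (B := 3 * P) (by positivity) (by
      rw [Finset.card_map, Fintype.card_fin, Fintype.card_fun, Fintype.card_fin, Fintype.card_fin,
        Nat.cast_pow, ← hM]
      have h1 : 8 * (M ^ 2 * n ^ 3 * P) ≤ (H.card : ℝ) ^ 3 := by
        rw [← hcube]
        calc _ = (2 * (n : ℝ) ^ ((r : ℝ) + 2 - 1 / 3 ^ (r + 1))) ^ 3 := by ring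
          _ ≤ _ := pow_le_pow_left₀ (by positivity) hH 3
      have h2 : 4 * (n ^ 3 * P) ≤ (H.card : ℝ) ^ 3 / (2 * M ^ 2) := by
        rw [le_div_iff₀ (by positivity)]
        linarith
      have h3 : 16 * M ≤ n ^ 3 * P := by
        calc 16 * M ≤ n ^ 2 * (n * P) := by
              gcongr
              nlinarith
          _ = n ^ 3 * P := by ring
      linarith)
  refine ⟨T, hT, H', hlt.le, fun y hy x hx => ?_⟩
  have := hmem y hy x hx
  rw [Finset.mem_map_equiv] at this
  exact this

theorem exists_cons_box {n r : ℕ} {H : Finset (Fin (r + 2) → Fin n)}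
    {H' : Finset (Fin (r + 1) → Fin n)} {T₀ : Finset (Fin n)} (hT₀ : T₀.card = 3)
    (hcons : ∀ y ∈ H', ∀ x ∈ T₀, (Fin.cons x y : Fin (r + 2) → Fin n) ∈ H)
    (hbox : ∃ T : Fin (r + 1) → Finset (Fin n), (∀ i, (T i).card = 3) ∧
      ∀ v, (∀ i, v i ∈ T i) → v ∈ H') :
    ∃ T : Fin (r + 2) → Finset (Fin n), (∀ i, (T i).card = 3) ∧
      ∀ v, (∀ i, v i ∈ T i) → v ∈ H := by
  obtain ⟨T, hT, hTH⟩ := hbox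
  refine ⟨Fin.cons T₀ T, fun i => ?_, fun v hv => ?_⟩
  · cases i using Fin.cases <;> simp [hT₀, hT]
  · rw [← Fin.cons_self_tail v]
    exact hcons _ (hTH _ fun i => by simpa [Fin.tail] using hv i.succ) _ (by simpa using hv 0)

theorem exists_box_of_three_mul_le_card {n r : ℕ} (hn : 4 ≤ n)
    (H : Finset (Fin (r + 1) → Fin n))
    (hH : 3 * (n : ℝ) ^ ((r : ℝ) + 1 - 1 / 3 ^ r) ≤ H.card) :
    ∃ T : Fin (r + 1) → Finset (Fin n), (∀ i, (T i).card = 3) ∧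
      ∀ v, (∀ i, v i ∈ T i) → v ∈ H := by
  induction r with
  | zero =>
    have h3 : 3 ≤ (H.image fun v => v 0).card := by
      rw [Finset.card_image_of_injective _ fun v v' h => funext fun i => by
        rwa [Fin.fin_one_eq_zero i]]
      have : (3 : ℝ) ≤ H.card := by simpa using hH
      exact_mod_cast this
    obtain ⟨T, hT, hT3⟩ := Finset.exists_subset_card_eq h3
    refine ⟨fun _ => T, fun _ => hT3, fun v hv => ?_⟩
    obtain ⟨v', hv', h⟩ := Finset.mem_image.1 (hT (hv 0))
    convert hv'
    ext i
    rw [Fin.fin_one_eq_zero i, h]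
  | succ r ih =>
    have h0 : (0 : ℝ) ≤ (n : ℝ) ^ ((r : ℝ) + 2 - 1 / 3 ^ (r + 1)) := by positivity
    have hexp : ((r + 1 : ℕ) : ℝ) + 1 = r + 2 := by push_cast; ring
    rw [hexp] at hH
    obtain ⟨T₀, hT₀, H', hH', hcons⟩ := exists_slice_of_card_ge hn H (by linarith)
    exact exists_cons_box hT₀ hcons (ih H' hH')

/-- **Erdős**: a `(d + 1)`-uniform hypergraph on `n` vertices with at least `n ^ (d + 1 - 1 / 3 ^ d)`
edges contains a complete `(d + 1)`-partite hypergraph with three vertices in each part. -/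
theorem exists_complete_partite_of_le_card {n d : ℕ} (hd : 1 ≤ d) (hn : 4 ≤ n)
    (E : Finset (Finset (Fin n))) (hE : ∀ F ∈ E, F.card = d + 1)
    (hcard : (n : ℝ) ^ ((d : ℝ) + 1 - 1 / 3 ^ d) ≤ E.card) :
    ∃ w : Fin (d + 1) × Fin 3 → Fin n, Function.Injective w ∧
      ∀ c : Fin (d + 1) → Fin 3, (Finset.univ.image fun i => w (i, c i)) ∈ E := by
  obtain ⟨r, rfl⟩ := Nat.exists_eq_add_of_le' hd
  set H : Finset (Fin (r + 2) → Fin n) :=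
    Finset.univ.filter fun v => Finset.univ.image v ∈ E
  have hHE : 2 * E.card ≤ H.card := by
    refine Finset.mul_card_image_le_card_of_maps_to (f := fun v => Finset.univ.image v)
      (fun v hv => (Finset.mem_filter.1 hv).2) 2 fun F hF => ?_
    let v (i : Fin (r + 2)) : Fin n := F.equivFinOfCardEq (hE F hF) |>.symm i
    have hv : Function.Injective v := Subtype.val_injective.comp (Equiv.injective _)
    have hvF : Finset.univ.image v = F := Finset.eq_of_subset_of_card_le
      (Finset.image_subset_iff.2 fun i _ => Subtype.prop _)
      (by rw [Finset.card_image_of_injective _ hv, hE F hF, Finset.card_fin])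
    have hvF' : Finset.univ.image (v ∘ Equiv.swap 0 1) = F := by
      rw [← Finset.image_image, Finset.image_univ_equiv, hvF]
    refine Finset.one_lt_card_iff.2 ⟨v, v ∘ Equiv.swap 0 1, by simp [hvF, hF],
      Finset.mem_filter.2 ⟨Finset.mem_filter.2 ⟨Finset.mem_univ _, hvF'.symm ▸ hF⟩, hvF'⟩,
      fun h => ?_⟩
    have := hv (congrFun h 0)
    simp at this
  have hexp : ((r + 1 : ℕ) : ℝ) + 1 = r + 2 := by push_cast; ring
  rw [hexp] at hcard
  have hHcard : 2 * (n : ℝ) ^ ((r : ℝ) + 2 - 1 / 3 ^ (r + 1)) ≤ H.card := by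
    have : (2 * E.card : ℝ) ≤ H.card := by exact_mod_cast hHE
    linarith
  obtain ⟨T₀, hT₀, H', hH', hcons⟩ := exists_slice_of_card_ge hn H hHcard
  obtain ⟨T, hT, hTH⟩ := exists_cons_box hT₀ hcons (exists_box_of_three_mul_le_card hn H' hH')
  let e (i) : T i ≃ Fin 3 := (T i).equivFinOfCardEq (hT i)
  have hmem (c : Fin (r + 2) → Fin 3) :
      (Finset.univ.image fun i => ((e i).symm (c i) : Fin n)) ∈ E :=
    (Finset.mem_filter.1 (hTH _ fun i => ((e i).symm (c i)).2)).2
  refine ⟨fun p => (e p.1).symm p.2, ?_, hmem⟩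
  rintro ⟨i, j⟩ ⟨i', j'⟩ h
  have hii : i = i' := by
    by_contra hne
    have h1 := hE _ (hmem (Function.update (fun _ => j') i j))
    have h2 := Finset.card_image_iff.1 (h1.trans (by simp))
    refine hne (h2 (Finset.mem_univ i) (Finset.mem_univ i') ?_)
    simpa [Function.update_of_ne (Ne.symm hne)] using h
  subst hii
  simpa using h

/-- For every d ≥ 1 and all sufficiently large n, every d-dimensional simplicial
complex on n vertices that embeds topologically into ℝ^{2d} has fewer than
n^{d+1 − 1/3^d} simplices of dimension d. -/
theorem stmt_16 (d : ℕ) (hd : 1 ≤ d) :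
    ∃ N : ℕ, ∀ n : ℕ, N ≤ n → ∀ K : Finset (Finset (Fin n)),
      K.Nonempty →
      (∀ F ∈ K, ∀ G ⊆ F, G ∈ K) →
      (∀ F ∈ K, F.card ≤ d + 1) →
      (∃ F ∈ K, F.card = d + 1) →
      (∀ v : Fin n, {v} ∈ K) →
      (∃ f : polyhedron n K → (Fin (2 * d) → ℝ), Continuous f ∧ Function.Injective f) →
      ((K.filter fun F => F.card = d + 1).card : ℝ) <
        (n : ℝ) ^ ((d : ℝ) + 1 - 1 / 3 ^ d) := by
  refine ⟨4, fun n hn K _ _ _ _ _ ⟨f, hf, hinj⟩ => ?_⟩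
  by_contra! hcard
  obtain ⟨w, hw, hface⟩ := exists_complete_partite_of_le_card hd hn
    (K.filter fun F => F.card = d + 1) (fun F hF => (Finset.mem_filter.1 hF).2) hcard
  exact not_injective_of_join_three_points w hw
    (fun c => (Finset.mem_filter.1 (hface c)).1) hf hinj
end

section
/- For every d ≥ 1 there exist a constant C > 0 and N ∈ ℕ such that for all n ≥ N there exists a (d+1)-uniform hypergraph on n vertices that contains no copy of any member of the family 𝓕_d and has at least C·n^{d+1 − 2(d+1)/(3^{d+1}−1)} edges; i.e., ex(n, 𝓕_d) ≥ C·n^{d+1 − 2(d+1)/(3^{d+1}−1)} for all n ≥ N. -/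
/-- A k-uniform hypergraph: a finite vertex set (of natural numbers) together
with a collection of k-element subsets of it, the edges. -/
structure HyperGraph (k : ℕ) where
  verts : Finset ℕ
  edges : Finset (Finset ℕ)
  edges_sub : ∀ e ∈ edges, e ⊆ verts
  uniform : ∀ e ∈ edges, e.card = k

/-- `H` contains a copy of `F`: an injective map of the vertex set of `F` into
that of `H` sending every edge of `F` to an edge of `H`. -/
def ContainsCopy {k : ℕ} (H F : HyperGraph k) : Prop :=
  ∃ φ : ℕ → ℕ, Set.InjOn φ F.verts ∧ (∀ v ∈ F.verts, φ v ∈ H.verts) ∧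
    ∀ e ∈ F.edges, e.image φ ∈ H.edges

/-- `H` is 𝓕-free: it contains no copy of any member of 𝓕. -/
def FreeOf {k : ℕ} (F : Set (HyperGraph k)) (H : HyperGraph k) : Prop :=
  ∀ G ∈ F, ¬ ContainsCopy H G

/-- ex(n, 𝓕): the maximum number of edges of an 𝓕-free k-graph on n vertices. -/
noncomputable def exNum (k n : ℕ) (F : Set (HyperGraph k)) : ℕ :=
  sSup {m : ℕ | ∃ H : HyperGraph k, H.verts.card = n ∧ FreeOf F H ∧ H.edges.card = m}

/-- The family 𝓕_d of (d+1)-uniform hypergraphs of d-simplices of the joins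
(Δ_{2d₁+2})^{≤d₁} * … * (Δ_{2dₛ+2})^{≤dₛ} with d₁ + … + dₛ = d − s + 1:
pairwise disjoint parts V₁,…,Vₛ with |Vᵢ| = 2dᵢ + 3, edges the sets meeting
each Vᵢ in exactly dᵢ + 1 vertices. -/
def FamilyF (d : ℕ) : Set (HyperGraph (d + 1)) :=
  { H | ∃ (s : ℕ) (dd : Fin s → ℕ) (V : Fin s → Finset ℕ),
      1 ≤ s ∧ (∑ i, dd i) + s = d + 1 ∧
      (∀ i j, i ≠ j → Disjoint (V i) (V j)) ∧
      (∀ i, (V i).card = 2 * dd i + 3) ∧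
      H.verts = Finset.univ.biUnion V ∧
      H.edges = (Finset.univ.biUnion V).powerset.filter
        fun e => ∀ i, (e ∩ V i).card = dd i + 1 }

open Finset

/-- Derandomised form of choosing a random subset of `K` with density `p`. -/
theorem exists_subset_expected_le {α ι : Type*} [DecidableEq α] {p : ℝ} (hp0 : 0 ≤ p)
    (hp1 : p ≤ 1) (K : Finset α) (I : Finset ι) (f : ι → Finset α) :
    ∃ A ⊆ K, p * #K - ∑ i ∈ I, p ^ #(f i) ≤ (#A : ℝ) - #{i ∈ I | f i ⊆ A} := by
  induction K using Finset.induction_on generalizing I f with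
  | empty =>
    refine ⟨∅, Subset.rfl, ?_⟩
    have h : (#{i ∈ I | f i ⊆ ∅} : ℝ) ≤ ∑ i ∈ I, p ^ #(f i) := by
      rw [card_filter, Nat.cast_sum]
      refine sum_le_sum fun i _ => ?_
      split_ifs with h
      · simp [subset_empty.1 h]
      · simpa using pow_nonneg hp0 _
    simpa using h
  | insert x K hx ih =>
    obtain ⟨A₁, hA₁, h₁⟩ := ih I fun i => (f i).erase x
    obtain ⟨A₂, hA₂, h₂⟩ := ih {i ∈ I | x ∉ f i} f
    have hxA₁ : x ∉ A₁ := fun h => hx (hA₁ h)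
    have hxA₂ : x ∉ A₂ := fun h => hx (hA₂ h)
    have e₂ : ({i ∈ {i ∈ I | x ∉ f i} | f i ⊆ A₂} : Finset ι) = {i ∈ I | f i ⊆ A₂} := by
      rw [filter_filter]
      exact filter_congr fun i _ => and_iff_right_of_imp fun h hxi => hxA₂ (h hxi)
    rw [e₂] at h₂
    have hsum : ∑ i ∈ I, p ^ #(f i)
        = p * ∑ i ∈ I, p ^ #((f i).erase x) + (1 - p) * ∑ i ∈ I with x ∉ f i, p ^ #(f i) := by
      rw [sum_filter, mul_sum, mul_sum, ← sum_add_distrib]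
      refine sum_congr rfl fun i _ => ?_
      by_cases h : x ∈ f i
      · rw [← card_erase_add_one h]
        simp [h, pow_succ']
      · simp only [h, not_false_eq_true, erase_eq_of_notMem, if_true]
        ring
    by_contra! hcon
    have c₁ := hcon (insert x A₁) (insert_subset_insert x hA₁)
    have c₂ := hcon A₂ (hA₂.trans (subset_insert x K))
    simp only [subset_insert_iff] at c₁
    rw [card_insert_of_notMem hx, hsum] at c₁ c₂
    rw [card_insert_of_notMem hxA₁] at c₁
    push_cast at c₁ c₂
    have m₁ := mul_le_mul_of_nonneg_left h₁ hp0
    have m₂ := mul_le_mul_of_nonneg_left h₂ (sub_nonneg.2 hp1)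
    rcases hp0.eq_or_lt with rfl | hp
    · linarith
    · nlinarith [mul_lt_mul_of_pos_left c₁ hp,
        mul_le_mul_of_nonneg_left c₂.le (sub_nonneg.2 hp1)]

/-- The deletion method. -/
theorem exists_subset_avoiding {α ι : Type*} [DecidableEq α] {p : ℝ} (hp0 : 0 ≤ p)
    (hp1 : p ≤ 1) (K : Finset α) (I : Finset ι) (f : ι → Finset α)
    (hf : ∀ i ∈ I, (f i).Nonempty) :
    ∃ A ⊆ K, (∀ i ∈ I, ¬ f i ⊆ A) ∧ p * #K - ∑ i ∈ I, p ^ #(f i) ≤ (#A : ℝ) := by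
  classical
  obtain ⟨A, hAK, hA⟩ := exists_subset_expected_le hp0 hp1 K I f
  rcases isEmpty_or_nonempty α with hα | hα
  · refine ⟨A, hAK, fun i hi => ?_, hA.trans (sub_le_self _ (Nat.cast_nonneg _))⟩
    exact isEmptyElim (hf i hi).choose
  choose! g hg using hf
  refine ⟨A \ image g {i ∈ I | f i ⊆ A}, sdiff_subset.trans hAK, fun i hi h => ?_, ?_⟩
  · have := mem_sdiff.1 (h (hg i hi))
    exact this.2 (mem_image_of_mem g (mem_filter.2 ⟨hi, h.trans sdiff_subset⟩))
  · have h₁ := le_card_sdiff (image g {i ∈ I | f i ⊆ A}) A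
    have h₂ : #(image g {i ∈ I | f i ⊆ A}) ≤ #{i ∈ I | f i ⊆ A} := card_image_le
    have h₃ : (#A : ℝ) ≤ #(A \ image g {i ∈ I | f i ⊆ A}) + #{i ∈ I | f i ⊆ A} := by
      exact_mod_cast (by omega)
    linarith

theorem three_pow_le_choose (m : ℕ) : 3 ^ m ≤ (2 * m + 1).choose m := by
  induction m with
  | zero => simp
  | succ m ih =>
    have h₁ : (2 * (m + 1) + 1).choose (m + 1)
        = (2 * m + 2).choose m + (2 * m + 2).choose (m + 1) := Nat.choose_succ_succ _ _
    have h₂ : (2 * m + 2).choose (m + 1)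
        = (2 * m + 1).choose m + (2 * m + 1).choose (m + 1) := Nat.choose_succ_succ _ _
    have h₃ : (2 * m + 1).choose m ≤ (2 * m + 2).choose m := Nat.choose_mono _ (by omega)
    have h₄ := Nat.choose_symm_half m
    rw [pow_succ]
    omega

/-- The sets in `⋃ W i` that meet each `W i` in exactly `m i + 1` vertices. -/
def joinEdges {s : ℕ} (m : Fin s → ℕ) (W : Fin s → Finset ℕ) : Finset (Finset ℕ) :=
  (univ.biUnion W).powerset.filter fun e => ∀ i, #(e ∩ W i) = m i + 1

theorem biUnion_inter_of_disjoint {s : ℕ} {W E : Fin s → Finset ℕ}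
    (hW : ∀ i j, i ≠ j → Disjoint (W i) (W j)) (hE : ∀ i, E i ⊆ W i) (i : Fin s) :
    univ.biUnion E ∩ W i = E i := by
  ext v
  simp only [mem_inter, mem_biUnion, mem_univ, true_and]
  refine ⟨?_, fun h => ⟨⟨i, h⟩, hE i h⟩⟩
  rintro ⟨⟨j, hj⟩, hi⟩
  by_cases hij : j = i
  · exact hij ▸ hj
  · exact absurd hi (disjoint_left.1 (hW j i hij) (hE j hj))

theorem three_pow_le_card_joinEdges {s : ℕ} (m : Fin s → ℕ) (W : Fin s → Finset ℕ)
    (hW : ∀ i j, i ≠ j → Disjoint (W i) (W j)) (hc : ∀ i, #(W i) = 2 * m i + 3) :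
    3 ^ (∑ i, m i + s) ≤ #(joinEdges m W) := by
  calc 3 ^ (∑ i, m i + s) = ∏ i, 3 ^ (m i + 1) := by
        rw [prod_pow_eq_pow_sum, sum_add_distrib]; simp
    _ ≤ ∏ i, #(powersetCard (m i + 1) (W i)) := by
        refine prod_le_prod' fun i _ => ?_
        rw [card_powersetCard, hc]
        exact three_pow_le_choose (m i + 1)
    _ = #(Fintype.piFinset fun i => powersetCard (m i + 1) (W i)) := by simp
    _ ≤ #(joinEdges m W) := by
        have key : ∀ E ∈ Fintype.piFinset fun i => powersetCard (m i + 1) (W i),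
            ∀ i, univ.biUnion E ∩ W i = E i := fun E hE =>
          biUnion_inter_of_disjoint hW fun i =>
            (mem_powersetCard.1 (Fintype.mem_piFinset.1 hE i)).1
        refine card_le_card_of_injOn (fun E => univ.biUnion E) (fun E hE => ?_) ?_
        · refine mem_filter.2 ⟨mem_powerset.2 (biUnion_mono fun i _ => ?_), fun i => ?_⟩
          · exact (mem_powersetCard.1 (Fintype.mem_piFinset.1 hE i)).1
          · simp only [key E hE i]
            exact (mem_powersetCard.1 (Fintype.mem_piFinset.1 hE i)).2
        · intro E hE E' hE' h
          funext i
          rw [← key E hE i, ← key E' hE' i]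
          exact congrArg (· ∩ W i) h

/-- The parameters `(s, d₁, …, dₛ)` of the members of the family for uniformity `k`. -/
def joinTypes (k : ℕ) : Finset (Σ s : ℕ, Fin s → ℕ) :=
  (range (k + 1)).sigma fun s =>
    {m ∈ Fintype.piFinset fun _ : Fin s => range (k + 1) | ∑ i, m i + s = k}

theorem mem_joinTypes {k : ℕ} {t : Σ s : ℕ, Fin s → ℕ} :
    t ∈ joinTypes k ↔ ∑ i, t.2 i + t.1 = k := by
  simp only [joinTypes, mem_sigma, mem_range, mem_filter, Fintype.mem_piFinset]
  refine ⟨fun h => h.2.2, fun h => ⟨by omega, fun i => ?_, h⟩⟩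
  have := single_le_sum (f := t.2) (fun _ _ => Nat.zero_le _) (mem_univ i)
  omega

/-- The possible placements of the parts `V₁, …, Vₛ` inside `{0, …, n - 1}`. -/
def joinPlacements (k n : ℕ) : Finset (Σ t : (Σ s : ℕ, Fin s → ℕ), Fin t.1 → Finset ℕ) :=
  (joinTypes k).sigma fun t =>
    {W ∈ Fintype.piFinset fun i => powersetCard (2 * t.2 i + 3) (range n) |
      ∀ i j, i ≠ j → Disjoint (W i) (W j)}

theorem mem_joinPlacements {k n : ℕ} {x : Σ t : (Σ s : ℕ, Fin s → ℕ), Fin t.1 → Finset ℕ} :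
    x ∈ joinPlacements k n ↔ ∑ i, x.1.2 i + x.1.1 = k ∧
      (∀ i, x.2 i ⊆ range n ∧ #(x.2 i) = 2 * x.1.2 i + 3) ∧
      ∀ i j, i ≠ j → Disjoint (x.2 i) (x.2 j) := by
  simp [joinPlacements, mem_joinTypes, mem_powersetCard]

theorem card_joinPlacements_le {k n : ℕ} (hn : 1 ≤ n) :
    #(joinPlacements k n) ≤ #(joinTypes k) * n ^ (3 * k) := by
  rw [joinPlacements, card_sigma, ← smul_eq_mul, ← sum_const]
  refine sum_le_sum fun t ht => ?_
  rw [mem_joinTypes] at ht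
  calc _ ≤ #(Fintype.piFinset fun i => powersetCard (2 * t.2 i + 3) (range n)) :=
        card_filter_le _ _
    _ = ∏ i, n.choose (2 * t.2 i + 3) := by simp
    _ ≤ ∏ i, n ^ (2 * t.2 i + 3) := prod_le_prod' fun i _ => Nat.choose_le_pow _ _
    _ = n ^ (2 * ∑ i, t.2 i + 3 * t.1) := by
        rw [prod_pow_eq_pow_sum, sum_add_distrib, ← mul_sum]; simp [mul_comm]
    _ ≤ n ^ (3 * k) := Nat.pow_le_pow_right hn (by omega)

theorem freeOf_familyF {d n : ℕ} {H : HyperGraph (d + 1)} (hv : H.verts = range n)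
    (hH : ∀ x ∈ joinPlacements (d + 1) n, ¬ joinEdges x.1.2 x.2 ⊆ H.edges) :
    FreeOf (FamilyF d) H := by
  rintro G ⟨s, m, V, -, hsum, hdisj, hcard, hGv, hGe⟩ ⟨φ, hinj, hmap, hedge⟩
  have hV : ∀ i, V i ⊆ G.verts := fun i => hGv ▸ subset_biUnion_of_mem V (mem_univ i)
  refine hH ⟨⟨s, m⟩, fun i => (V i).image φ⟩ (mem_joinPlacements.2 ⟨hsum, fun i => ⟨?_, ?_⟩,
    fun i j hij => ?_⟩) fun e he => ?_
  · intro v hv'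
    obtain ⟨w, hw, rfl⟩ := mem_image.1 hv'
    exact hv ▸ hmap w (hV i hw)
  · exact (card_image_of_injOn (hinj.mono (hV i))).trans (hcard i)
  · refine disjoint_left.2 fun v h₁ h₂ => ?_
    obtain ⟨w, hw, rfl⟩ := mem_image.1 h₁
    obtain ⟨w', hw', h⟩ := mem_image.1 h₂
    rw [hinj (hV j hw') (hV i hw) h] at hw'
    exact disjoint_left.1 (hdisj i j hij) hw hw'
  · obtain ⟨hsub, he⟩ := mem_filter.1 he
    rw [mem_powerset] at hsub
    have himage : ({v ∈ G.verts | φ v ∈ e} : Finset ℕ).image φ = e := by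
      ext u
      simp only [mem_image, mem_filter]
      constructor
      · rintro ⟨v, hv', rfl⟩
        exact hv'.2
      · intro hu
        obtain ⟨i, -, hi⟩ := mem_biUnion.1 (hsub hu)
        obtain ⟨v, hvi, rfl⟩ := mem_image.1 hi
        exact ⟨v, ⟨hV i hvi, hu⟩, rfl⟩
    rw [← himage]
    refine hedge _ ?_
    rw [hGe]
    refine mem_filter.2 ⟨mem_powerset.2 (hGv ▸ filter_subset _ _), fun i => ?_⟩
    rw [← he i, ← card_image_of_injOn (hinj.mono (inter_subset_right.trans (hV i)))]
    congr 1
    ext u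
    simp only [mem_image, mem_inter, mem_filter]
    constructor
    · rintro ⟨v, ⟨hv', hvi⟩, rfl⟩
      exact ⟨hv'.2, v, hvi, rfl⟩
    · rintro ⟨hu, v, hvi, rfl⟩
      exact ⟨v, ⟨⟨hV i hvi, hu⟩, hvi⟩, rfl⟩

theorem card_edges_le_exNum {k n : ℕ} {F : Set (HyperGraph k)} {H : HyperGraph k}
    (hn : H.verts.card = n) (hF : FreeOf F H) : H.edges.card ≤ exNum k n F := by
  refine le_csSup ⟨2 ^ n, ?_⟩ ⟨H, hn, hF, rfl⟩
  rintro _ ⟨G, hG, -, rfl⟩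
  rw [← hG, ← card_powerset]
  exact card_le_card fun e he => mem_powerset.2 (G.edges_sub e he)

theorem exists_freeOf_familyF {d n : ℕ} (hn : 1 ≤ n) {p : ℝ} (hp0 : 0 ≤ p) (hp1 : p ≤ 1) :
    ∃ H : HyperGraph (d + 1), H.verts.card = n ∧ FreeOf (FamilyF d) H ∧
      p * n.choose (d + 1) - #(joinTypes (d + 1)) * (n : ℝ) ^ (3 * (d + 1)) * p ^ 3 ^ (d + 1)
        ≤ (H.edges.card : ℝ) := by
  have hcard : ∀ x ∈ joinPlacements (d + 1) n, 3 ^ (d + 1) ≤ #(joinEdges x.1.2 x.2) := by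
    intro x hx
    obtain ⟨h₁, h₂, h₃⟩ := mem_joinPlacements.1 hx
    exact h₁ ▸ three_pow_le_card_joinEdges _ _ h₃ fun i => (h₂ i).2
  obtain ⟨A, hAK, hA, hle⟩ := exists_subset_avoiding hp0 hp1 (powersetCard (d + 1) (range n))
    (joinPlacements (d + 1) n) (fun x => joinEdges x.1.2 x.2)
    fun x hx => card_pos.1 ((pow_pos (by norm_num) _).trans_le (hcard x hx))
  refine ⟨⟨range n, A, fun e he => (mem_powersetCard.1 (hAK he)).1,
    fun e he => (mem_powersetCard.1 (hAK he)).2⟩, card_range n, freeOf_familyF rfl hA, ?_⟩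
  have hsum : ∑ x ∈ joinPlacements (d + 1) n, p ^ #(joinEdges x.1.2 x.2)
      ≤ #(joinTypes (d + 1)) * (n : ℝ) ^ (3 * (d + 1)) * p ^ 3 ^ (d + 1) := by
    refine (sum_le_card_nsmul _ _ _ fun x hx =>
      pow_le_pow_of_le_one hp0 hp1 (hcard x hx)).trans ?_
    rw [nsmul_eq_mul]
    exact mul_le_mul_of_nonneg_right (by exact_mod_cast card_joinPlacements_le hn)
      (pow_nonneg hp0 _)
  rw [card_powersetCard, card_range] at hle
  linarith

theorem pow_le_mul_choose {k n : ℕ} (h : 2 * k ≤ n) :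
    (n : ℝ) ^ k ≤ 2 ^ k * k.factorial * n.choose k := by
  have h₁ : ((n + 1 - k : ℕ) : ℝ) ^ k ≤ k.factorial * n.choose k := by
    have := Nat.pow_le_choose (α := ℝ) k n
    rwa [div_le_iff₀' (by positivity)] at this
  have h₂ : (n : ℝ) ≤ 2 * (n + 1 - k : ℕ) := by exact_mod_cast (by omega)
  calc (n : ℝ) ^ k ≤ (2 * (n + 1 - k : ℕ)) ^ k := by gcongr
    _ = 2 ^ k * ((n + 1 - k : ℕ) : ℝ) ^ k := mul_pow _ _ _
    _ ≤ 2 ^ k * (k.factorial * n.choose k) := by gcongr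
    _ = _ := by ring

/-- For every d ≥ 1 there are C > 0 and N such that for all n ≥ N there is an
𝓕_d-free (d+1)-graph on n vertices with at least C·n^{d+1 − 2(d+1)/(3^{d+1}−1)}
edges; i.e. ex(n,𝓕_d) ≥ C·n^{d+1 − 2(d+1)/(3^{d+1}−1)}. -/
theorem stmt_18 (d : ℕ) (hd : 1 ≤ d) :
    ∃ C : ℝ, 0 < C ∧ ∃ N : ℕ, ∀ n : ℕ, N ≤ n →
      (∃ H : HyperGraph (d + 1), H.verts.card = n ∧ FreeOf (FamilyF d) H ∧
        C * (n : ℝ) ^ (((d : ℝ) + 1) - 2 * ((d : ℝ) + 1) / ((3 : ℝ) ^ (d + 1) - 1))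
          ≤ (H.edges.card : ℝ)) ∧
      C * (n : ℝ) ^ (((d : ℝ) + 1) - 2 * ((d : ℝ) + 1) / ((3 : ℝ) ^ (d + 1) - 1))
        ≤ (exNum (d + 1) n (FamilyF d) : ℝ) := by
  obtain ⟨k, hk⟩ : ∃ k, k = d + 1 := ⟨_, rfl⟩
  obtain ⟨q, hq⟩ : ∃ q, 3 ^ k = q + 2 := ⟨3 ^ k - 2, by
    have := Nat.pow_le_pow_right (n := 3) (by norm_num) (show 1 ≤ k by omega)
    omega⟩
  have hqR : (3 : ℝ) ^ k = q + 2 := by exact_mod_cast hq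
  have hkR : (d : ℝ) + 1 = k := by rw [hk]; push_cast; rfl
  rw [show (3 : ℝ) ^ (d + 1) = q + 2 from hk ▸ hqR, hkR]
  set a : ℝ := 2 * (k : ℝ) / ((q : ℝ) + 2 - 1) with ha
  have ha0 : 0 ≤ a := div_nonneg (by positivity) (by linarith [(Nat.cast_nonneg q : (0 : ℝ) ≤ q)])
  have haq : a * (q + 1) = 2 * k := by
    rw [ha, show (q : ℝ) + 2 - 1 = q + 1 by ring]
    field_simp
  set T : ℝ := Nat.cast #(joinTypes k)
  set D : ℝ := 2 ^ k * k.factorial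
  have hT : 0 ≤ T := Nat.cast_nonneg _
  have hD : 1 ≤ D := one_le_mul_of_one_le_of_one_le (one_le_pow₀ one_le_two)
    (by exact_mod_cast k.factorial_pos)
  set c : ℝ := 1 / (2 * D * (T + 1)) with hc
  have hc0 : 0 < c := by positivity
  have hcD : c * (2 * D * (T + 1)) = 1 := by rw [hc]; field_simp
  have hc1 : c ≤ 1 := by rw [hc, div_le_one (by positivity)]; nlinarith
  refine ⟨c / (2 * D), by positivity, 2 * k, fun n hn => ?_⟩
  have hn1 : 1 ≤ n := by omega
  have hnR : (1 : ℝ) ≤ n := by exact_mod_cast hn1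
  have hn0 : (0 : ℝ) < n := by linarith
  set p : ℝ := c * (n : ℝ) ^ (-a) with hp
  have hp0 : 0 ≤ p := by positivity
  have hp1 : p ≤ 1 := mul_le_one₀ hc1 (by positivity)
    (Real.rpow_le_one_of_one_le_of_nonpos hnR (by linarith))
  have hpn : (n : ℝ) ^ (2 * k) * p ^ (q + 1) ≤ c := by
    have h : ((n : ℝ) ^ (-a)) ^ (q + 1) = ((n : ℝ) ^ (2 * k))⁻¹ := by
      rw [← Real.rpow_natCast, ← Real.rpow_mul hn0.le, ← Real.rpow_natCast,
        ← Real.rpow_neg hn0.le]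
      push_cast
      rw [neg_mul, haq]
    rw [hp, mul_pow, h, mul_left_comm, mul_inv_cancel₀ (by positivity), mul_one]
    exact pow_le_of_le_one hc0.le hc1 (by omega)
  have hmain : (n : ℝ) ^ ((k : ℝ) - a) * c = p * (n : ℝ) ^ k := by
    rw [sub_eq_add_neg, Real.rpow_add hn0, Real.rpow_natCast, hp]
    ring
  obtain ⟨H, hHn, hHF, hHe⟩ := exists_freeOf_familyF (d := d) hn1 hp0 hp1
  replace hHe : p * n.choose k - T * (n : ℝ) ^ (3 * k) * p ^ (q + 2) ≤ (H.edges.card : ℝ) := by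
    rw [← hq]
    subst hk
    exact hHe
  have hbound : c / (2 * D) * (n : ℝ) ^ ((k : ℝ) - a) ≤ H.edges.card := by
    refine le_trans ?_ hHe
    have h₁ : p * ((n : ℝ) ^ k / D) ≤ p * n.choose k := by
      refine mul_le_mul_of_nonneg_left ?_ hp0
      rw [div_le_iff₀' (by positivity)]
      exact pow_le_mul_choose hn
    have h₂ : T * (n : ℝ) ^ (3 * k) * p ^ (q + 2) ≤ p * (n : ℝ) ^ k * (1 / (2 * D)) := by
      calc T * (n : ℝ) ^ (3 * k) * p ^ (q + 2)
          = p * (n : ℝ) ^ k * (T * ((n : ℝ) ^ (2 * k) * p ^ (q + 1))) := by ring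
        _ ≤ p * (n : ℝ) ^ k * (1 / (2 * D)) := by
          refine mul_le_mul_of_nonneg_left ?_ (by positivity)
          refine (mul_le_mul_of_nonneg_left hpn hT).trans ?_
          rw [le_div_iff₀ (by positivity)]
          nlinarith [mul_pos hc0 (by linarith : (0 : ℝ) < D)]
    have h₃ : c / (2 * D) * (n : ℝ) ^ ((k : ℝ) - a) + p * (n : ℝ) ^ k * (1 / (2 * D))
        = p * ((n : ℝ) ^ k / D) := by
      rw [div_mul_eq_mul_div, mul_comm c, hmain]
      field_simp
      ring
    linarith
  exact ⟨⟨H, hHn, hHF, hbound⟩, hbound.trans (by exact_mod_cast card_edges_le_exNum hHn hHF)⟩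
end
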